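/- arXiv:2506.17216 — 3 statements merged into one kernel-verified Lean document; each statement's English description precedes it below -/
import Mathlib

section
/- If 𝒟 is a symmetric (15,8,4)-design of type (C3), then the action of Aut(𝒟) on the point set Fin 15 has exactly three orbits, of sizes 1, 6 and 8 (one point is fixed by every automorphism), and the action of Aut(𝒟) on the set of blocks (where σ sends a block B to its image σ(B)) also has exactly three orbits, of sizes 1, 6 and 8. -/
/-- A symmetric (15,8,4)-design: 15 blocks, each an 8-element subset of `Fin 15`,
any two distinct blocks meeting in exactly 4 points. -/
def IsDesign (B : Finset (Finset (Fin 15))) : Prop :=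
  B.card = 15 ∧ (∀ b ∈ B, b.card = 8) ∧
    ∀ b ∈ B, ∀ b' ∈ B, b ≠ b' → (b ∩ b').card = 4

private lemma exists_preimage' {β : Type*} [Finite β] {P : β → Prop} {F : β → β}
    (hF : Function.Injective F) (h : ∀ b, P b → P (F b)) {b : β} (hb : P b) :
    ∃ b', P b' ∧ F b' = b := by
  have hGinj : Function.Injective (fun x : {x // P x} => (⟨F x.1, h _ x.2⟩ : {x // P x})) := by
    intro x y hxy
    exact Subtype.ext (hF (congrArg Subtype.val hxy))
  obtain ⟨x, hx⟩ := (Finite.injective_iff_surjective.mp hGinj) ⟨b, hb⟩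
  exact ⟨x.1, x.2, congrArg Subtype.val hx⟩

/-- The full automorphism group of the design with block family `B`. -/
def designAut (B : Finset (Finset (Fin 15))) : Subgroup (Equiv.Perm (Fin 15)) where
  carrier := {σ | ∀ b ∈ B, b.image ⇑σ ∈ B}
  one_mem' := by intro b hb; simpa using hb
  mul_mem' := by
    intro a c ha hc b hb
    have := ha _ (hc b hb)
    simpa [Finset.image_image, Equiv.Perm.coe_mul] using this
  inv_mem' := by
    intro σ hσ b hb
    obtain ⟨b', hb', hEq⟩ := exists_preimage' (F := fun s => Finset.image (⇑σ) s)
      (Finset.image_injective σ.injective) (fun s hs => hσ s hs) hb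
    rw [← hEq, Finset.image_image]
    have : ⇑σ⁻¹ ∘ ⇑σ = id := by
      funext x; simp
    rw [this, Finset.image_id]
    exact hb'

/-- `O` is a center point of the block family `B`. -/
def IsCenter (B : Finset (Finset (Fin 15))) (O : Finset (Fin 15)) : Prop :=
  O ∈ B ∧ ∀ b ∈ B, b ≠ O → symmDiff O b ∈ B

/-- A line contained in the block family: a set of three blocks of the form
`{b₁, b₂, b₁ △ b₂}`. -/
def IsLineIn (B : Finset (Finset (Fin 15))) (l : Set (Finset (Fin 15))) : Prop :=
  ∃ b₁ ∈ B, ∃ b₂ ∈ B, b₁ ≠ b₂ ∧ symmDiff b₁ b₂ ∈ B ∧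
    l = {b₁, b₂, symmDiff b₁ b₂}

/-- The orbit of a point under the automorphism group of the design. -/
def pointOrbit (B : Finset (Finset (Fin 15))) (x : Fin 15) : Set (Fin 15) :=
  {y | ∃ σ ∈ designAut B, y = σ x}

/-- The orbit of a block under the automorphism group of the design. -/
def blockOrbit (B : Finset (Finset (Fin 15))) (b : Finset (Fin 15)) :
    Set (Finset (Fin 15)) :=
  {b' | ∃ σ ∈ designAut B, b' = b.image ⇑σ}

/-- The conclusion on orbit lengths, as a predicate of the block family. -/
def HasOrbitLengths (B : Finset (Finset (Fin 15))) : Prop :=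
  (∃ S₁ S₂ S₃ : Set (Fin 15),
      {S | ∃ x : Fin 15, S = pointOrbit B x} = {S₁, S₂, S₃} ∧
      S₁.ncard = 1 ∧ S₂.ncard = 6 ∧ S₃.ncard = 8) ∧
    (∃ T₁ T₂ T₃ : Set (Finset (Fin 15)),
      {T | ∃ b ∈ B, T = blockOrbit B b} = {T₁, T₂, T₃} ∧
      T₁.ncard = 1 ∧ T₂.ncard = 6 ∧ T₃.ncard = 8)

/-- The block family obtained by renaming the points along `σ`. -/
def relabel (σ : Equiv.Perm (Fin 15)) (B : Finset (Finset (Fin 15))) :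
    Finset (Finset (Fin 15)) :=
  B.image (Finset.image σ)

section Relabel

variable {B : Finset (Finset (Fin 15))} (σ : Equiv.Perm (Fin 15))

lemma mem_relabel {b : Finset (Fin 15)} : b ∈ relabel σ B ↔ b.image ⇑σ⁻¹ ∈ B := by
  constructor
  · intro h
    obtain ⟨c, hc, rfl⟩ := Finset.mem_image.mp h
    simpa [Finset.image_image, Function.comp_def] using hc
  · intro h
    refine Finset.mem_image.mpr ⟨_, h, ?_⟩
    simp [Finset.image_image, Function.comp_def]

lemma image_mem_relabel {b : Finset (Fin 15)} (h : b ∈ B) : b.image σ ∈ relabel σ B :=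
  Finset.mem_image_of_mem _ h

lemma relabel_inv_relabel : relabel σ⁻¹ (relabel σ B) = B := by
  ext b
  simp [mem_relabel, Finset.image_image, Function.comp_def]

lemma relabel_relabel_inv : relabel σ (relabel σ⁻¹ B) = B := by
  simpa using relabel_inv_relabel (B := B) σ⁻¹

lemma IsDesign.relabel (h : IsDesign B) : IsDesign (relabel σ B) := by
  obtain ⟨h₁, h₂, h₃⟩ := h
  refine ⟨?_, ?_, ?_⟩
  · rw [_root_.relabel, Finset.card_image_of_injective _ (Finset.image_injective σ.injective), h₁]
  · intro b hb
    obtain ⟨c, hc, rfl⟩ := Finset.mem_image.mp hb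
    rw [Finset.card_image_of_injective _ σ.injective, h₂ c hc]
  · intro b hb b' hb' hne
    obtain ⟨c, hc, rfl⟩ := Finset.mem_image.mp hb
    obtain ⟨c', hc', rfl⟩ := Finset.mem_image.mp hb'
    rw [← Finset.image_inter _ _ σ.injective, Finset.card_image_of_injective _ σ.injective]
    exact h₃ c hc c' hc' (fun h => hne (by rw [h]))

lemma IsCenter.relabel {O : Finset (Fin 15)} (h : IsCenter B O) :
    IsCenter (relabel σ B) (O.image σ) := by
  refine ⟨image_mem_relabel σ h.1, ?_⟩
  intro b hb hne
  obtain ⟨c, hc, rfl⟩ := Finset.mem_image.mp hb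
  rw [← Finset.image_symmDiff _ _ σ.injective]
  exact image_mem_relabel σ (h.2 c hc (fun h => hne (by rw [h])))

lemma conj_mem_designAut_relabel {g : Equiv.Perm (Fin 15)} (hg : g ∈ designAut B) :
    σ * g * σ⁻¹ ∈ designAut (relabel σ B) := by
  intro b hb
  obtain ⟨c, hc, rfl⟩ := Finset.mem_image.mp hb
  have := image_mem_relabel σ (hg c hc)
  simpa [Finset.image_image, Function.comp_def] using this

lemma mem_designAut_relabel {g : Equiv.Perm (Fin 15)} :
    g ∈ designAut (relabel σ B) ↔ ∃ g' ∈ designAut B, g = σ * g' * σ⁻¹ := by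
  constructor
  · intro hg
    refine ⟨σ⁻¹ * g * σ, ?_, by group⟩
    simpa [relabel_inv_relabel] using conj_mem_designAut_relabel σ⁻¹ hg
  · rintro ⟨g', hg', rfl⟩
    exact conj_mem_designAut_relabel σ hg'

lemma pointOrbit_relabel (x : Fin 15) :
    pointOrbit (relabel σ B) (σ x) = σ '' pointOrbit B x := by
  ext y
  simp only [pointOrbit, mem_designAut_relabel, Set.mem_ofPred_eq, Set.mem_image]
  constructor
  · rintro ⟨_, ⟨g, hg, rfl⟩, rfl⟩
    exact ⟨g x, ⟨g, hg, rfl⟩, by simp⟩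
  · rintro ⟨_, ⟨g, hg, rfl⟩, rfl⟩
    exact ⟨_, ⟨g, hg, rfl⟩, by simp⟩

lemma blockOrbit_relabel (b : Finset (Fin 15)) :
    blockOrbit (relabel σ B) (b.image σ) = Finset.image σ '' blockOrbit B b := by
  ext y
  simp only [blockOrbit, mem_designAut_relabel, Set.mem_ofPred_eq, Set.mem_image]
  constructor
  · rintro ⟨_, ⟨g, hg, rfl⟩, rfl⟩
    exact ⟨b.image g, ⟨g, hg, rfl⟩, by simp [Finset.image_image, Function.comp_def]⟩
  · rintro ⟨_, ⟨g, hg, rfl⟩, rfl⟩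
    exact ⟨_, ⟨g, hg, rfl⟩, by simp [Finset.image_image, Function.comp_def]⟩

lemma HasOrbitLengths.relabel (h : HasOrbitLengths B) : HasOrbitLengths (relabel σ B) := by
  obtain ⟨⟨S₁, S₂, S₃, hS, h₁, h₂, h₃⟩, T₁, T₂, T₃, hT, k₁, k₂, k₃⟩ := h
  have hi := Finset.image_injective σ.injective
  refine ⟨⟨σ '' S₁, σ '' S₂, σ '' S₃, ?_, ?_, ?_, ?_⟩,
    Finset.image σ '' T₁, Finset.image σ '' T₂, Finset.image σ '' T₃, ?_, ?_, ?_, ?_⟩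
  · have : {S | ∃ x : Fin 15, S = pointOrbit (_root_.relabel σ B) x} =
        Set.image σ '' {S | ∃ x : Fin 15, S = pointOrbit B x} := by
      ext S
      constructor
      · rintro ⟨x, rfl⟩
        exact ⟨_, ⟨σ⁻¹ x, rfl⟩, by simp [← pointOrbit_relabel]⟩
      · rintro ⟨_, ⟨x, rfl⟩, rfl⟩
        exact ⟨σ x, (pointOrbit_relabel σ x).symm⟩
    rw [this, hS]
    simp [Set.image_insert_eq]
  · rwa [Set.ncard_image_of_injective _ σ.injective]
  · rwa [Set.ncard_image_of_injective _ σ.injective]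
  · rwa [Set.ncard_image_of_injective _ σ.injective]
  · have : {T | ∃ b ∈ _root_.relabel σ B, T = blockOrbit (_root_.relabel σ B) b} =
        Set.image (Finset.image σ) '' {T | ∃ b ∈ B, T = blockOrbit B b} := by
      ext T
      constructor
      · rintro ⟨b, hb, rfl⟩
        obtain ⟨c, hc, rfl⟩ := Finset.mem_image.mp hb
        exact ⟨_, ⟨c, hc, rfl⟩, (blockOrbit_relabel σ c).symm⟩
      · rintro ⟨_, ⟨b, hb, rfl⟩, rfl⟩
        exact ⟨_, image_mem_relabel σ hb, (blockOrbit_relabel σ b).symm⟩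
    rw [this, hT]
    simp [Set.image_insert_eq]
  · rwa [Set.ncard_image_of_injective _ hi]
  · rwa [Set.ncard_image_of_injective _ hi]
  · rwa [Set.ncard_image_of_injective _ hi]

end Relabel

section Coordinates

lemma card_filter_comp {α β : Type*} [Fintype α] [Fintype β] [DecidableEq β]
    (f : α → β) (P : β → Prop) [DecidablePred P] :
    (Finset.univ.filter fun a => P (f a)).card =
      ∑ v, if P v then (Finset.univ.filter fun a => f a = v).card else 0 := by
  rw [← Finset.sum_filter, Finset.card_eq_sum_card_fiberwise (f := f)
    (t := Finset.univ.filter P) (by intro a; simp)]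
  refine Finset.sum_congr rfl fun v hv => ?_
  congr 1
  ext a
  simp only [Finset.mem_filter, Finset.mem_univ, true_and] at hv ⊢
  constructor
  · exact fun h => h.2
  · rintro rfl
    exact ⟨hv, rfl⟩

/-- The incidences of a point with four given sets. -/
def incidence (O A B C : Finset (Fin 15)) (x : Fin 15) : Bool × Bool × Bool × Bool :=
  (decide (x ∈ O), decide (x ∈ A), decide (x ∈ B), decide (x ∈ C))

set_option maxHeartbeats 1000000 in
/-- Four sets which meet each other like four independent hyperplane complements of `PG(3,2)`
can be moved to the coordinate ones. -/
lemma exists_coordinates {O A B C : Finset (Fin 15)}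
    (hO : O.card = 8) (hA : A.card = 8) (hB : B.card = 8) (hC : C.card = 8)
    (hOA : (O ∩ A).card = 4) (hOB : (O ∩ B).card = 4) (hOC : (O ∩ C).card = 4)
    (hAB : (A ∩ B).card = 4) (hAC : (A ∩ C).card = 4) (hBC : (B ∩ C).card = 4)
    (hOAB : (symmDiff O A ∩ B).card = 4) (hOAC : (symmDiff O A ∩ C).card = 4)
    (hOBC : (symmDiff O B ∩ C).card = 4) (hABC : (symmDiff A B ∩ C).card = 4)
    (hOABC : (symmDiff O (symmDiff A B) ∩ C).card = 4) :
    ∃ σ : Equiv.Perm (Fin 15), ∀ k : Fin 15,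
      incidence O A B C (σ k) = ((k + 1 : ℕ).testBit 0, (k + 1 : ℕ).testBit 1,
        (k + 1 : ℕ).testBit 2, (k + 1 : ℕ).testBit 3) := by
  have key (S : Finset (Fin 15)) (P : Bool × Bool × Bool × Bool → Prop) [DecidablePred P]
      (h : ∀ x, x ∈ S ↔ P (incidence O A B C x)) : S.card = ∑ v, if P v then
        (Finset.univ.filter fun a => incidence O A B C a = v).card else 0 := by
    rw [← card_filter_comp]
    congr 1
    ext x
    simp [h]
  have hsd (S T : Finset (Fin 15)) (x : Fin 15) :
      x ∈ symmDiff S T ↔ decide (x ∈ S) ≠ decide (x ∈ T) := by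
    rw [Finset.mem_symmDiff]
    by_cases h : x ∈ S <;> by_cases h' : x ∈ T <;> simp [h, h']
  have hcell : ∀ v ≠ (false, false, false, false),
      (Finset.univ.filter fun a => incidence O A B C a = v).card = 1 := by
    rw [key _ (fun v => v.1) (by simp [incidence])] at hO
    rw [key _ (fun v => v.2.1) (by simp [incidence])] at hA
    rw [key _ (fun v => v.2.2.1) (by simp [incidence])] at hB
    rw [key _ (fun v => v.2.2.2) (by simp [incidence])] at hC
    rw [key _ (fun v => v.1 && v.2.1) (by simp [incidence])] at hOA
    rw [key _ (fun v => v.1 && v.2.2.1) (by simp [incidence])] at hOB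
    rw [key _ (fun v => v.1 && v.2.2.2) (by simp [incidence])] at hOC
    rw [key _ (fun v => v.2.1 && v.2.2.1) (by simp [incidence])] at hAB
    rw [key _ (fun v => v.2.1 && v.2.2.2) (by simp [incidence])] at hAC
    rw [key _ (fun v => v.2.2.1 && v.2.2.2) (by simp [incidence])] at hBC
    rw [key _ (fun v => v.1 ≠ v.2.1 ∧ v.2.2.1)
      (by simp [incidence, hsd])] at hOAB
    rw [key _ (fun v => v.1 ≠ v.2.1 ∧ v.2.2.2)
      (by simp [incidence, hsd])] at hOAC
    rw [key _ (fun v => v.1 ≠ v.2.2.1 ∧ v.2.2.2)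
      (by simp [incidence, hsd])] at hOBC
    rw [key _ (fun v => v.2.1 ≠ v.2.2.1 ∧ v.2.2.2)
      (by simp [incidence, hsd])] at hABC
    rw [key _ (fun v => v.1 ≠ decide (v.2.1 ≠ v.2.2.1) ∧ v.2.2.2)
      (by simp [incidence, hsd])] at hOABC
    have huniv := key Finset.univ (fun _ => True) (by simp)
    simp [Fintype.sum_prod_type]
      at hO hA hB hC hOA hOB hOC hAB hAC hBC hOAB hOAC hOBC hABC hOABC huniv
    rintro ⟨_ | _, _ | _, _ | _, _ | _⟩ hv <;> first | exact absurd rfl hv | omega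
  have hex (k : Fin 15) : ∃ x, incidence O A B C x = ((k + 1 : ℕ).testBit 0,
      (k + 1 : ℕ).testBit 1, (k + 1 : ℕ).testBit 2, (k + 1 : ℕ).testBit 3) := by
    have hne : ((k + 1 : ℕ).testBit 0, (k + 1 : ℕ).testBit 1, (k + 1 : ℕ).testBit 2,
        (k + 1 : ℕ).testBit 3) ≠ (false, false, false, false) := by
      revert k
      decide
    obtain ⟨x, hx⟩ := Finset.card_pos.mp (by rw [hcell _ hne]; exact one_pos)
    exact ⟨x, (Finset.mem_filter.mp hx).2⟩
  choose f hf using hex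
  have hinj : Function.Injective f := by
    intro k l h
    have := hf k
    rw [h, hf l] at this
    clear h
    revert k l
    decide
  exact ⟨Equiv.ofBijective f (Finite.injective_iff_bijective.mp hinj), hf⟩

end Coordinates

section NormalForm

/-- The set of points whose indices are the positions of the binary digits `1` of `n`. -/
def bitSet (n : ℕ) : Finset (Fin 15) := Finset.univ.filter fun k => n.testBit k

/-- The blocks spanned by a center point, a line avoiding it and one further block,
in coordinates. -/
def baseMasks : List ℕ :=
  [21845, 26214, 13107, 30840, 11565, 7710, 19275, 32640, 10965]

/-- The blocks encoded by `baseMasks`. -/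
def baseBlocks : Finset (Finset (Fin 15)) := (baseMasks.map bitSet).toFinset

/-- The transversal of the seven pairs `{v, v + 8}` given by `f`, together with the point `7`. -/
def transversal (f : Fin 7 → Bool) : Finset (Fin 15) :=
  Finset.univ.filter fun k => k.val = 7 ∨ ∃ v : Fin 7, k.val = if f v then v.val + 8 else v.val

/-- The encodings of the sets which can extend `baseBlocks` to a design, up to symmetric
difference with the center point. -/
def extraMask (i j : Fin 3) : ℕ :=
  2 ^ 7 + ∑ v : Fin 7,
    2 ^ (if v.val = 0 ∨ v.val = 2 * i + 1 ∨ v.val = 2 * j + 2 then v.val + 8 else v.val)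

/-- The encodings of the blocks of the design which matches the extra blocks along `p`. -/
def standardMasks (p : Fin 3 → Fin 3) : List ℕ :=
  baseMasks ++ List.ofFn (fun i => extraMask i (p i)) ++
    List.ofFn fun i => 21845 ^^^ extraMask i (p i)

/-- The design which matches the extra blocks along `p`. -/
def standardBlocks (p : Fin 3 → Fin 3) : Finset (Finset (Fin 15)) :=
  ((standardMasks p).map bitSet).toFinset

lemma mem_standardBlocks {p : Fin 3 → Fin 3} {b : Finset (Fin 15)} :
    b ∈ standardBlocks p ↔ ∃ n ∈ standardMasks p, bitSet n = b := by
  simp [standardBlocks]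

lemma bitSet_xor (m n : ℕ) : bitSet (m ^^^ n) = symmDiff (bitSet m) (bitSet n) := by
  ext k
  simp only [bitSet, Finset.mem_symmDiff, Finset.mem_filter, Finset.mem_univ, true_and,
    Nat.testBit_xor]
  cases m.testBit k <;> cases n.testBit k <;> simp

lemma image_bitSet {f : Fin 15 → Fin 15} (hf : Function.Injective f) {m n : ℕ}
    (h : ∀ k, m.testBit (f k) = n.testBit k) : (bitSet n).image f = bitSet m := by
  ext y
  obtain ⟨x, rfl⟩ := (Finite.injective_iff_surjective.mp hf) y
  rw [hf.mem_finset_image]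
  simp [bitSet, h]

lemma card_inter_bitSet (b : Finset (Fin 15)) (n : ℕ) :
    (b ∩ bitSet n).card =
      ∑ k : Fin 15, if n.testBit k then (if k ∈ b then 1 else 0) else 0 := by
  have : b ∩ bitSet n = (bitSet n).filter (· ∈ b) := by
    ext x
    simp [and_comm]
  rw [this, Finset.card_filter, bitSet, Finset.sum_filter]

set_option maxHeartbeats 1000000 in
lemma pair_sum_eq_one {x : Fin 15 → ℕ}
    (h₁ : ∑ k : Fin 15, (if Nat.testBit 21845 k then x k else 0) = 4)
    (h₂ : ∑ k : Fin 15, (if Nat.testBit 26214 k then x k else 0) = 4)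
    (h₃ : ∑ k : Fin 15, (if Nat.testBit 13107 k then x k else 0) = 4)
    (h₄ : ∑ k : Fin 15, (if Nat.testBit 30840 k then x k else 0) = 4)
    (h₅ : ∑ k : Fin 15, (if Nat.testBit 11565 k then x k else 0) = 4)
    (h₆ : ∑ k : Fin 15, (if Nat.testBit 7710 k then x k else 0) = 4)
    (h₇ : ∑ k : Fin 15, (if Nat.testBit 19275 k then x k else 0) = 4)
    (h₈ : ∑ k : Fin 15, (if Nat.testBit 32767 k then x k else 0) = 8) :
    x 7 = 1 ∧ ∀ v : Fin 7, x (v.castLE (by omega)) + x (Fin.natAdd 8 v) = 1 := by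
  simp [Fin.sum_univ_succ, Nat.testBit, Nat.shiftRight_eq_div_pow] at h₁ h₂ h₃ h₄ h₅ h₆ h₇ h₈
  have h7 : x 7 = 1 := by omega
  refine ⟨h7, fun v => ?_⟩
  fin_cases v <;> simp [Fin.natAdd, Fin.castLE] <;> linarith

lemma exists_eq_transversal {b : Finset (Fin 15)} (hb : b.card = 8)
    (h : ∀ c ∈ baseBlocks, (b ∩ c).card = 4) : ∃ f, b = transversal f := by
  have hall : (b ∩ bitSet 32767).card = 8 := by
    rwa [show bitSet 32767 = Finset.univ by decide, Finset.inter_univ]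
  have hbase (n : ℕ) (hn : bitSet n ∈ baseBlocks) := h _ hn
  simp only [card_inter_bitSet] at hall hbase
  obtain ⟨h7, hpair⟩ := pair_sum_eq_one (x := fun k => if k ∈ b then 1 else 0)
    (hbase _ (by simp [baseBlocks, baseMasks])) (hbase _ (by simp [baseBlocks, baseMasks]))
    (hbase _ (by simp [baseBlocks, baseMasks])) (hbase _ (by simp [baseBlocks, baseMasks]))
    (hbase _ (by simp [baseBlocks, baseMasks])) (hbase _ (by simp [baseBlocks, baseMasks]))
    (hbase _ (by simp [baseBlocks, baseMasks])) hall
  refine ⟨fun v => decide ((Fin.natAdd 8 v : Fin 15) ∈ b), ?_⟩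
  have hpair' (v : Fin 7) : (v.castLE (by omega) : Fin 15) ∈ b ↔
      (Fin.natAdd 8 v : Fin 15) ∉ b := by
    have := hpair v
    by_cases h₁ : (v.castLE (by omega) : Fin 15) ∈ b <;>
      by_cases h₂ : (Fin.natAdd 8 v : Fin 15) ∈ b <;> simp_all
  have h7' : (7 : Fin 15) ∈ b := by simpa using h7
  ext k
  simp only [transversal, Finset.mem_filter, Finset.mem_univ, true_and, decide_eq_true_eq]
  rcases lt_trichotomy k.val 7 with hk | hk | hk
  · have hv := hpair' ⟨k, hk⟩
    have hkv : (Fin.castLE (by omega) (⟨k, hk⟩ : Fin 7) : Fin 15) = k := rfl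
    rw [hkv] at hv
    rw [hv]
    constructor
    · intro hn
      exact Or.inr ⟨⟨k, hk⟩, by rw [if_neg hn]⟩
    · rintro (h' | ⟨v, hv'⟩)
      · omega
      · split_ifs at hv' with hif
        · omega
        · rwa [show (⟨k, hk⟩ : Fin 7) = v from Fin.ext hv']
  · obtain rfl : k = 7 := Fin.ext hk
    simp [h7']
  · have hkv : (Fin.natAdd 8 (⟨k - 8, by omega⟩ : Fin 7) : Fin 15) = k :=
      Fin.ext (by simp; omega)
    constructor
    · intro hb
      refine Or.inr ⟨⟨k - 8, by omega⟩, ?_⟩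
      rw [hkv, if_pos hb]
      simp
      omega
    · rintro (h' | ⟨v, hv'⟩)
      · omega
      · split_ifs at hv' with hif
        · rwa [show k = Fin.natAdd 8 v from Fin.ext (by simp; omega)]
        · omega

lemma exists_eq_bitSet_extraMask {b : Finset (Fin 15)} (hb : b.card = 8)
    (h : ∀ c ∈ baseBlocks, (b ∩ c).card = 4) :
    ∃ i j, b = bitSet (extraMask i j) ∨ b = symmDiff (bitSet 21845) (bitSet (extraMask i j)) := by
  obtain ⟨f, rfl⟩ := exists_eq_transversal hb h
  have h₁ := h (bitSet 32640) (by simp [baseBlocks, baseMasks])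
  have h₂ := h (bitSet 10965) (by simp [baseBlocks, baseMasks])
  clear h hb
  revert f
  decide +kernel

lemma bitSet_extraMask_ne_row (i j j' : Fin 3) (h : j ≠ j') :
    bitSet (extraMask i j) ≠ bitSet (extraMask i j') := by
  revert i j j'
  decide +kernel

lemma bitSet_extraMask_ne_col (i i' j : Fin 3) (h : i ≠ i') :
    bitSet (extraMask i j) ≠ bitSet (extraMask i' j) := by
  revert i i' j
  decide +kernel

lemma inter_bitSet_extraMask_row (i j j' : Fin 3) (h : j ≠ j') :
    (bitSet (extraMask i j) ∩ bitSet (extraMask i j')).card ≠ 4 := by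
  revert i j j'
  decide +kernel

lemma inter_bitSet_extraMask_col (i i' j : Fin 3) (h : i ≠ i') :
    (bitSet (extraMask i j) ∩ bitSet (extraMask i' j)).card ≠ 4 := by
  revert i i' j
  decide +kernel

lemma exists_eq_standardBlocks {B : Finset (Finset (Fin 15))} (hB : IsDesign B)
    (hbase : baseBlocks ⊆ B) (hO : IsCenter B (bitSet 21845)) :
    ∃ p : Fin 3 → Fin 3, Function.Injective p ∧ B = standardBlocks p := by
  obtain ⟨hcard, hsize, hinter⟩ := hB
  have hsymm (i j : Fin 3) : symmDiff (bitSet 21845) (bitSet (extraMask i j)) ∈ B ↔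
      bitSet (extraMask i j) ∈ B := by
    have hne : bitSet (extraMask i j) ≠ bitSet 21845 ∧
        symmDiff (bitSet 21845) (bitSet (extraMask i j)) ≠ bitSet 21845 := by
      revert i j
      decide +kernel
    exact ⟨fun h => by simpa using hO.2 _ h hne.2, fun h => hO.2 _ h hne.1⟩
  set M : Finset (Fin 3 × Fin 3) := Finset.univ.filter
    fun q => bitSet (extraMask q.1 q.2) ∈ B with hM
  have hcover : B ⊆ baseBlocks ∪ M.image (fun q => bitSet (extraMask q.1 q.2)) ∪
      M.image fun q => symmDiff (bitSet 21845) (bitSet (extraMask q.1 q.2)) := by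
    intro b hb
    by_cases hb' : b ∈ baseBlocks
    · simp [hb']
    obtain ⟨i, j, rfl | rfl⟩ := exists_eq_bitSet_extraMask (hsize b hb)
      (fun c hc => hinter b hb c (hbase hc) (by rintro rfl; exact hb' hc))
    · exact Finset.mem_union_left _ (Finset.mem_union_right _
        (Finset.mem_image.mpr ⟨(i, j), by simpa [hM] using hb, rfl⟩))
    · exact Finset.mem_union_right _
        (Finset.mem_image.mpr ⟨(i, j), by simpa [hM] using (hsymm i j).mp hb, rfl⟩)
  have hM3 : 3 ≤ M.card := by
    have h₁ := Finset.card_le_card hcover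
    have h₂ := Finset.card_union_le (baseBlocks ∪ M.image (fun q => bitSet (extraMask q.1 q.2)))
      (M.image fun q => symmDiff (bitSet 21845) (bitSet (extraMask q.1 q.2)))
    have h₃ := Finset.card_union_le baseBlocks (M.image (fun q => bitSet (extraMask q.1 q.2)))
    have h₄ := Finset.card_image_le (s := M) (f := fun q => bitSet (extraMask q.1 q.2))
    have h₅ := Finset.card_image_le (s := M)
      (f := fun q => symmDiff (bitSet 21845) (bitSet (extraMask q.1 q.2)))
    have h₆ : baseBlocks.card ≤ 9 := by decide +kernel
    omega
  have hmem (i j : Fin 3) : (i, j) ∈ M ↔ bitSet (extraMask i j) ∈ B := by simp [hM]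
  have hrow : Set.InjOn Prod.fst (M : Set (Fin 3 × Fin 3)) := by
    rintro ⟨i, j⟩ hq ⟨i', j'⟩ hq' rfl
    by_contra hne
    have hj : j ≠ j' := fun h => hne (by rw [h])
    have h4 := inter_bitSet_extraMask_row i j j' hj
    refine h4 (hinter _ ((hmem i j).mp hq) _ ((hmem i j').mp hq') fun h => ?_)
    exact bitSet_extraMask_ne_row i j j' hj h
  have hfst : M.image Prod.fst = Finset.univ := by
    rw [← Finset.card_eq_iff_eq_univ]
    refine le_antisymm (Finset.card_le_univ _) ?_
    rw [Finset.card_image_of_injOn hrow]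
    simpa using hM3
  have hex (i : Fin 3) : ∃ j, bitSet (extraMask i j) ∈ B := by
    obtain ⟨⟨i', j⟩, hq, rfl⟩ := Finset.mem_image.mp (hfst ▸ Finset.mem_univ i)
    exact ⟨j, (hmem i' j).mp hq⟩
  choose p hp using hex
  have hinj : Function.Injective p := by
    intro i i' h
    by_contra hne
    refine inter_bitSet_extraMask_col i i' (p i) hne (hinter _ (hp i) _ (h ▸ hp i') ?_)
    exact bitSet_extraMask_ne_col i i' (p i) hne
  refine ⟨p, hinj, (Finset.eq_of_subset_of_card_le ?_ ?_).symm⟩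
  · intro b hb
    obtain ⟨n, hn, rfl⟩ := mem_standardBlocks.mp hb
    simp only [standardMasks, List.mem_append, List.mem_ofFn] at hn
    obtain (hn | ⟨i, rfl⟩) | ⟨i, rfl⟩ := hn
    · exact hbase (by simpa [baseBlocks] using ⟨n, hn, rfl⟩)
    · exact hp i
    · rw [bitSet_xor]
      exact (hsymm _ _).mpr (hp i)
  · rw [hcard]
    clear hp
    revert p
    decide +kernel

lemma eq_cycle_of_unique_center {p : Fin 3 → Fin 3} (hp : Function.Injective p)
    (h : ∀ c, IsCenter (standardBlocks p) c → c = bitSet 21845) :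
    p = ![1, 2, 0] ∨ p = ![2, 0, 1] := by
  have key : ∀ p : Fin 3 → Fin 3, Function.Injective p → p ≠ ![1, 2, 0] → p ≠ ![2, 0, 1] →
      ∃ c ∈ baseMasks, c ≠ 21845 ∧ ∀ n ∈ standardMasks p, n ≠ c → c ^^^ n ∈ standardMasks p := by
    decide +kernel
  have hne : ∀ c ∈ baseMasks, c ≠ 21845 → bitSet c ≠ bitSet 21845 := by
    decide +kernel
  by_contra! hcon
  obtain ⟨c, hc, hcO, hcen⟩ := key p hp hcon.1 hcon.2
  refine hne c hc hcO (h _ ⟨mem_standardBlocks.mpr ⟨c, by simp [standardMasks, hc], rfl⟩, ?_⟩)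
  intro b hb hbc
  obtain ⟨n, hn, rfl⟩ := mem_standardBlocks.mp hb
  exact mem_standardBlocks.mpr
    ⟨_, hcen n hn (fun h => hbc (by rw [h])), bitSet_xor c n⟩

end NormalForm

section Orbits

variable {B : Finset (Finset (Fin 15))}

lemma relabel_eq_of_mem_designAut {σ : Equiv.Perm (Fin 15)} (hσ : σ ∈ designAut B) :
    relabel σ B = B := by
  refine Finset.eq_of_subset_of_card_le ?_ ?_
  · intro b hb
    obtain ⟨c, hc, rfl⟩ := Finset.mem_image.mp hb
    exact hσ c hc
  · rw [relabel, Finset.card_image_of_injective _ (Finset.image_injective σ.injective)]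

/-- The number of blocks whose symmetric difference with `b` is a block. -/
def blockDegree (B : Finset (Finset (Fin 15))) (b : Finset (Fin 15)) : ℕ :=
  (B.filter fun c => symmDiff b c ∈ B).card

/-- The sum of the degrees of the blocks through `x`. -/
def pointWeight (B : Finset (Finset (Fin 15))) (x : Fin 15) : ℕ :=
  ∑ b ∈ B, if x ∈ b then blockDegree B b else 0

lemma blockDegree_image {σ : Equiv.Perm (Fin 15)} (hσ : σ ∈ designAut B)
    (b : Finset (Fin 15)) : blockDegree B (b.image σ) = blockDegree B b := by
  have hB := relabel_eq_of_mem_designAut hσ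
  have hi := Finset.image_injective σ.injective
  have hmem (c : Finset (Fin 15)) : c.image σ ∈ B ↔ c ∈ B := by
    conv_lhs => rw [← hB]
    exact hi.mem_finset_image
  have himage : B.filter (fun c => symmDiff (b.image σ) c ∈ B) =
      (B.filter fun c => symmDiff b c ∈ B).image (Finset.image σ) := by
    ext c
    constructor
    · intro hc
      obtain ⟨hcB, hc⟩ := Finset.mem_filter.mp hc
      rw [← hB] at hcB
      obtain ⟨d, hd, rfl⟩ := Finset.mem_image.mp hcB
      rw [← Finset.image_symmDiff _ _ σ.injective, hmem] at hc
      exact Finset.mem_image_of_mem _ (Finset.mem_filter.mpr ⟨hd, hc⟩)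
    · intro hc
      obtain ⟨d, hd, rfl⟩ := Finset.mem_image.mp hc
      obtain ⟨hdB, hd⟩ := Finset.mem_filter.mp hd
      refine Finset.mem_filter.mpr ⟨(hmem d).mpr hdB, ?_⟩
      rwa [← Finset.image_symmDiff _ _ σ.injective, hmem]
  rw [blockDegree, himage, Finset.card_image_of_injective _ hi, blockDegree]

lemma pointWeight_apply {σ : Equiv.Perm (Fin 15)} (hσ : σ ∈ designAut B) (x : Fin 15) :
    pointWeight B (σ x) = pointWeight B x := by
  have hB := relabel_eq_of_mem_designAut hσ
  have hi := Finset.image_injective σ.injective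
  calc pointWeight B (σ x)
      = ∑ b ∈ relabel σ B, if σ x ∈ b then blockDegree B b else 0 := by rw [hB, pointWeight]
    _ = ∑ b ∈ B, if σ x ∈ b.image σ then blockDegree B (b.image σ) else 0 :=
        Finset.sum_image hi.injOn
    _ = pointWeight B x := by
        simp only [blockDegree_image hσ, σ.injective.mem_finset_image, pointWeight]

lemma orbits_eq_of_invariant {G α : Type*} [Group G] (H : Subgroup G) (act : G → α → α)
    (hmul : ∀ g h x, act (g * h) x = act g (act h x))
    {X : Set α} (hX : ∀ g ∈ H, ∀ x ∈ X, act g x ∈ X) (w : α → ℕ)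
    (hw : ∀ g ∈ H, ∀ x, w (act g x) = w x) {R : Set α} (hR : R ⊆ X)
    (hcover : ∀ x ∈ X, ∃ r ∈ R, ∃ g ∈ H, x = act g r) (hinj : Set.InjOn w R) :
    {S | ∃ x ∈ X, S = {y | ∃ g ∈ H, y = act g x}} = (fun r => {y ∈ X | w y = w r}) '' R := by
  have horbit : ∀ x ∈ X, {y | ∃ g ∈ H, y = act g x} = {y ∈ X | w y = w x} := by
    intro x hx
    ext y
    constructor
    · rintro ⟨g, hg, rfl⟩
      exact ⟨hX g hg x hx, hw g hg x⟩
    · rintro ⟨hy, hyx⟩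
      obtain ⟨r, hr, g, hg, rfl⟩ := hcover x hx
      obtain ⟨s, hs, h, hh, rfl⟩ := hcover y hy
      rw [hw g hg, hw h hh] at hyx
      obtain rfl := hinj hs hr hyx
      exact ⟨h * g⁻¹, H.mul_mem hh (H.inv_mem hg), by rw [← hmul]; simp⟩
  ext S
  constructor
  · rintro ⟨x, hx, rfl⟩
    obtain ⟨r, hr, g, hg, rfl⟩ := hcover x hx
    refine ⟨r, hr, ?_⟩
    rw [horbit _ hx, hw g hg]
  · rintro ⟨r, hr, rfl⟩
    exact ⟨r, hR hr, (horbit r (hR hr)).symm⟩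

/-- Automorphisms of `standardBlocks ![1, 2, 0]` which suffice to connect all points and all
blocks that can be connected. -/
def standardAuts : List (Fin 15 → Fin 15) :=
  [![6, 3, 2, 5, 0, 1, 4, 7, 14, 11, 10, 13, 8, 9, 12],
   ![10, 5, 12, 1, 8, 3, 14, 7, 2, 13, 4, 9, 0, 11, 6],
   ![2, 9, 8, 3, 14, 13, 4, 7, 10, 1, 0, 11, 6, 5, 12],
   ![8, 1, 2, 11, 12, 13, 6, 7, 0, 9, 10, 3, 4, 5, 14],
   ![12, 13, 10, 9, 6, 3, 0, 7, 4, 5, 2, 1, 14, 11, 8],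
   ![0, 3, 12, 13, 6, 9, 10, 7, 8, 11, 4, 5, 14, 1, 2],
   ![4, 9, 6, 11, 8, 5, 10, 7, 12, 1, 14, 3, 0, 13, 2],
   ![14, 11, 2, 5, 0, 9, 12, 7, 6, 3, 10, 13, 8, 1, 4]]

lemma standardMasks_cycle : standardMasks ![1, 2, 0] =
    [21845, 26214, 13107, 30840, 11565, 7710, 19275, 32640, 10965,
      5100, 18870, 9690, 18105, 7395, 28815] := by
  decide +kernel

lemma exists_mem_designAut_of_mem_standardAuts {f : Fin 15 → Fin 15} (hf : f ∈ standardAuts) :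
    ∃ σ ∈ designAut (standardBlocks ![1, 2, 0]), ⇑σ = f := by
  have key : ∀ f ∈ standardAuts, Function.Injective f ∧ ∀ n ∈ standardMasks ![1, 2, 0],
      ∃ m ∈ standardMasks ![1, 2, 0], ∀ k, m.testBit (f k) = n.testBit k := by
    rw [standardMasks_cycle]
    simp only [standardAuts, List.forall_mem_cons]
    refine ⟨?_, ?_, ?_, ?_, ?_, ?_, ?_, ?_, by simp⟩ <;> decide +kernel
  obtain ⟨hinj, h⟩ := key f hf
  refine ⟨Equiv.ofBijective f (Finite.injective_iff_bijective.mp hinj), ?_, rfl⟩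
  intro b hb
  obtain ⟨n, hn, rfl⟩ := mem_standardBlocks.mp hb
  obtain ⟨m, hm, hmn⟩ := h n hn
  exact mem_standardBlocks.mpr ⟨m, hm, (image_bitSet hinj hmn).symm⟩

lemma hasOrbitLengths_standardBlocks : HasOrbitLengths (standardBlocks ![1, 2, 0]) := by
  obtain ⟨B, hB⟩ : ∃ B, B = standardBlocks ![1, 2, 0] := ⟨_, rfl⟩
  rw [← hB]
  constructor
  · have h := orbits_eq_of_invariant (designAut B) (fun σ x => σ x) (by simp)
      (X := Set.univ) (by simp) (pointWeight B) (fun σ hσ x => pointWeight_apply hσ x)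
      (R := {7, 1, 0}) (Set.subset_univ _) ?_ ?_
    · refine ⟨{y | pointWeight B y = pointWeight B 7}, {y | pointWeight B y = pointWeight B 1},
        {y | pointWeight B y = pointWeight B 0}, ?_, ?_, ?_, ?_⟩
      · simpa [Set.image_insert_eq, pointOrbit] using h
      · rw [← Finset.coe_filter_univ, Set.ncard_coe_finset, hB]
        decide +kernel
      · rw [← Finset.coe_filter_univ, Set.ncard_coe_finset, hB]
        decide +kernel
      · rw [← Finset.coe_filter_univ, Set.ncard_coe_finset, hB]
        decide +kernel
    · intro x _
      have key : ∀ x : Fin 15, ∃ r ∈ ({7, 1, 0} : Finset (Fin 15)), ∃ f ∈ standardAuts,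
          x = f r := by
        decide +kernel
      obtain ⟨r, hr, f, hf, rfl⟩ := key x
      obtain ⟨σ, hσ, rfl⟩ := exists_mem_designAut_of_mem_standardAuts hf
      rw [← hB] at hσ
      exact ⟨r, by simpa using hr, σ, hσ, rfl⟩
    · have key : ∀ r ∈ ({7, 1, 0} : Finset (Fin 15)), ∀ s ∈ ({7, 1, 0} : Finset (Fin 15)),
          pointWeight (standardBlocks ![1, 2, 0]) r = pointWeight (standardBlocks ![1, 2, 0]) s →
            r = s := by
        decide +kernel
      intro r hr s hs
      rw [hB]
      exact key r (by simpa using hr) s (by simpa using hs)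
  · have hsub : ({bitSet 21845, bitSet 7710, bitSet 5100} : Finset (Finset (Fin 15))) ⊆ B := by
      rw [hB]
      decide +kernel
    have hX : ∀ σ ∈ designAut B, ∀ b ∈ (B : Set (Finset (Fin 15))),
        b.image ⇑σ ∈ (B : Set (Finset (Fin 15))) := fun σ hσ b hb =>
      Finset.mem_coe.mpr (hσ b (Finset.mem_coe.mp hb))
    have h := orbits_eq_of_invariant (designAut B)
      (fun (σ : Equiv.Perm (Fin 15)) (b : Finset (Fin 15)) => b.image ⇑σ)
      (fun σ τ b => by rw [Finset.image_image, Equiv.Perm.coe_mul]) hX (blockDegree B)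
      (fun σ hσ b => blockDegree_image hσ b) (Finset.coe_subset.mpr hsub) ?_ ?_
    · refine ⟨{y | y ∈ B ∧ blockDegree B y = blockDegree B (bitSet 21845)},
        {y | y ∈ B ∧ blockDegree B y = blockDegree B (bitSet 7710)},
        {y | y ∈ B ∧ blockDegree B y = blockDegree B (bitSet 5100)}, ?_, ?_, ?_, ?_⟩
      · simpa [Set.image_insert_eq, blockOrbit] using h
      · rw [← Finset.coe_filter, Set.ncard_coe_finset, hB]
        decide +kernel
      · rw [← Finset.coe_filter, Set.ncard_coe_finset, hB]
        decide +kernel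
      · rw [← Finset.coe_filter, Set.ncard_coe_finset, hB]
        decide +kernel
    · intro b hb
      have key : ∀ n ∈ standardMasks ![1, 2, 0], ∃ m ∈ [21845, 7710, 5100], ∃ f ∈ standardAuts,
          ∀ k, n.testBit (f k) = m.testBit k := by
        rw [standardMasks_cycle]
        simp only [List.forall_mem_cons]
        refine ⟨?_, ?_, ?_, ?_, ?_, ?_, ?_, ?_, ?_, ?_, ?_, ?_, ?_, ?_, ?_, by simp⟩ <;>
          decide +kernel
      rw [hB] at hb
      obtain ⟨n, hn, hnb⟩ := mem_standardBlocks.mp (Finset.mem_coe.mp hb)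
      obtain ⟨m, hm, f, hf, hmn⟩ := key n hn
      obtain ⟨σ, hσ, rfl⟩ := exists_mem_designAut_of_mem_standardAuts hf
      rw [← hB] at hσ
      refine ⟨bitSet m, ?_, σ, hσ, by rw [← hnb, image_bitSet σ.injective hmn]⟩
      simp only [List.mem_cons, List.not_mem_nil, or_false] at hm
      obtain rfl | rfl | rfl := hm <;> simp
    · have h₁ : blockDegree B (bitSet 21845) ≠ blockDegree B (bitSet 7710) := by
        rw [hB]
        decide +kernel
      have h₂ : blockDegree B (bitSet 21845) ≠ blockDegree B (bitSet 5100) := by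
        rw [hB]
        decide +kernel
      have h₃ : blockDegree B (bitSet 7710) ≠ blockDegree B (bitSet 5100) := by
        rw [hB]
        decide +kernel
      intro r hr s hs hrs
      simp only [Finset.coe_insert, Finset.coe_singleton, Set.mem_insert_iff,
        Set.mem_singleton_iff] at hr hs
      obtain rfl | rfl | rfl := hr <;> obtain rfl | rfl | rfl := hs <;>
        first | rfl | exact absurd hrs ‹_› | exact absurd hrs.symm ‹_›

lemma standardBlocks_other_cycle : standardBlocks ![2, 0, 1] =
    relabel (Equiv.swap 1 3 * Equiv.swap 2 4 * Equiv.swap 9 11 * Equiv.swap 10 12)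
      (standardBlocks ![1, 2, 0]) := by
  decide +kernel

end Orbits

section Main

variable {B : Finset (Finset (Fin 15))}

lemma image_inv_eq_bitSet {σ : Equiv.Perm (Fin 15)} {S : Finset (Fin 15)} {n : ℕ}
    (h : ∀ k, decide (σ k ∈ S) = n.testBit k) : S.image ⇑σ⁻¹ = bitSet n := by
  ext k
  have hk := (σ⁻¹).injective.mem_finset_image (s := S) (a := σ k)
  rw [show σ⁻¹ (σ k) = k by simp] at hk
  rw [hk, bitSet, Finset.mem_filter, ← h]
  simp

lemma exists_baseBlocks_subset_relabel (hD : IsDesign B) {O : Finset (Fin 15)}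
    (hO : IsCenter B O) {l : Set (Finset (Fin 15))} (hl : IsLineIn B l) (hOl : O ∉ l) :
    ∃ σ : Equiv.Perm (Fin 15), baseBlocks ⊆ relabel σ⁻¹ B ∧ O.image ⇑σ⁻¹ = bitSet 21845 := by
  obtain ⟨hcard, hsize, hinter⟩ := hD
  obtain ⟨P, hP, Q, hQ, hPQ, hPQB, rfl⟩ := hl
  simp only [Set.mem_insert_iff, Set.mem_singleton_iff, not_or] at hOl
  obtain ⟨hOP, hOQ, hOPQ⟩ := hOl
  have hOPB := hO.2 P hP (Ne.symm hOP)
  have hOQB := hO.2 Q hQ (Ne.symm hOQ)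
  have hOPQB := hO.2 _ hPQB (Ne.symm hOPQ)
  obtain ⟨C, hC, hCnot⟩ : ∃ C ∈ B, C ∉ [O, P, Q, symmDiff P Q, symmDiff O P, symmDiff O Q,
      symmDiff O (symmDiff P Q)].toFinset := by
    refine Finset.exists_mem_notMem_of_card_lt_card ?_
    rw [hcard]
    exact (List.toFinset_card_le _).trans_lt (by simp)
  simp only [List.mem_toFinset, List.mem_cons, List.not_mem_nil, or_false, not_or] at hCnot
  obtain ⟨hCO, hCP, hCQ, hCPQ, hCOP, hCOQ, hCOPQ⟩ := hCnot
  have hOPne : symmDiff O P ≠ Q := by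
    rintro rfl
    exact hOPQ (by rw [symmDiff_comm O P, symmDiff_symmDiff_cancel_left])
  obtain ⟨σ, hσ⟩ := exists_coordinates (hsize O hO.1) (hsize P hP) (hsize Q hQ) (hsize C hC)
    (hinter O hO.1 P hP hOP) (hinter O hO.1 Q hQ hOQ) (hinter O hO.1 C hC (Ne.symm hCO))
    (hinter P hP Q hQ hPQ) (hinter P hP C hC (Ne.symm hCP)) (hinter Q hQ C hC (Ne.symm hCQ))
    (hinter _ hOPB Q hQ hOPne) (hinter _ hOPB C hC (Ne.symm hCOP))
    (hinter _ hOQB C hC (Ne.symm hCOQ)) (hinter _ hPQB C hC (Ne.symm hCPQ))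
    (hinter _ hOPQB C hC (Ne.symm hCOPQ))
  simp only [incidence, Prod.mk.injEq] at hσ
  have hOσ : O.image ⇑σ⁻¹ = bitSet 21845 :=
    image_inv_eq_bitSet fun k => (hσ k).1.trans (by revert k; decide)
  have hPσ : P.image ⇑σ⁻¹ = bitSet 26214 :=
    image_inv_eq_bitSet fun k => (hσ k).2.1.trans (by revert k; decide)
  have hQσ : Q.image ⇑σ⁻¹ = bitSet 30840 :=
    image_inv_eq_bitSet fun k => (hσ k).2.2.1.trans (by revert k; decide)
  have hCσ : C.image ⇑σ⁻¹ = bitSet 32640 :=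
    image_inv_eq_bitSet fun k => (hσ k).2.2.2.trans (by revert k; decide)
  have hxor {S T : Finset (Fin 15)} {m n : ℕ} (hS : S.image ⇑σ⁻¹ = bitSet m)
      (hT : T.image ⇑σ⁻¹ = bitSet n) : (symmDiff S T).image ⇑σ⁻¹ = bitSet (m ^^^ n) := by
    rw [Finset.image_symmDiff _ _ (σ⁻¹).injective, hS, hT, bitSet_xor]
  have hmem {S : Finset (Fin 15)} {n : ℕ} (hS : S ∈ B) (h : S.image ⇑σ⁻¹ = bitSet n) :
      bitSet n ∈ relabel σ⁻¹ B := h ▸ image_mem_relabel σ⁻¹ hS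
  refine ⟨σ, ?_, hOσ⟩
  intro b hb
  obtain ⟨n, hn, rfl⟩ := List.mem_map.mp (List.mem_toFinset.mp hb)
  simp only [baseMasks, List.mem_cons, List.not_mem_nil, or_false] at hn
  obtain rfl | rfl | rfl | rfl | rfl | rfl | rfl | rfl | rfl := hn
  · exact hmem hO.1 hOσ
  · exact hmem hP hPσ
  · exact hmem hOPB (hxor hOσ hPσ)
  · exact hmem hQ hQσ
  · exact hmem hOQB (hxor hOσ hQσ)
  · exact hmem hPQB (hxor hPσ hQσ)
  · exact hmem hOPQB (hxor hOσ (hxor hPσ hQσ))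
  · exact hmem hC hCσ
  · exact hmem (hO.2 C hC hCO) (hxor hOσ hCσ)

lemma hasOrbitLengths_of_baseBlocks_subset (hD : IsDesign B) (hbase : baseBlocks ⊆ B)
    (hO : IsCenter B (bitSet 21845)) (huniq : ∀ c, IsCenter B c → c = bitSet 21845) :
    HasOrbitLengths B := by
  obtain ⟨p, hp, rfl⟩ := exists_eq_standardBlocks hD hbase hO
  obtain rfl | rfl := eq_cycle_of_unique_center hp huniq
  · exact hasOrbitLengths_standardBlocks
  · rw [standardBlocks_other_cycle]
    exact hasOrbitLengths_standardBlocks.relabel _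

end Main

/-- for a design of type (C3), the actions of `Aut(𝒟)` on points and on
blocks each have exactly three orbits, of sizes 1, 6 and 8. -/
theorem stmt15 (B : Finset (Finset (Fin 15))) (hD : IsDesign B)
    (hC3 : ∃ O, IsCenter B O ∧ (∀ O', IsCenter B O' → O' = O) ∧
      ∃ l, IsLineIn B l ∧ O ∉ l) :
    (∃ S₁ S₂ S₃ : Set (Fin 15),
      {S | ∃ x : Fin 15, S = pointOrbit B x} = {S₁, S₂, S₃} ∧
      S₁.ncard = 1 ∧ S₂.ncard = 6 ∧ S₃.ncard = 8) ∧
    (∃ T₁ T₂ T₃ : Set (Finset (Fin 15)),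
      {T | ∃ b ∈ B, T = blockOrbit B b} = {T₁, T₂, T₃} ∧
      T₁.ncard = 1 ∧ T₂.ncard = 6 ∧ T₃.ncard = 8) := by
  obtain ⟨O, hO, huniq, l, hl, hOl⟩ := hC3
  obtain ⟨σ, hbase, hOσ⟩ := exists_baseBlocks_subset_relabel hD hO hl hOl
  have h : HasOrbitLengths (relabel σ⁻¹ B) := by
    refine hasOrbitLengths_of_baseBlocks_subset (hD.relabel _) hbase (hOσ ▸ hO.relabel _) ?_
    intro c hc
    have hc' := hc.relabel σ
    rw [relabel_relabel_inv] at hc'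
    rw [← hOσ, ← huniq _ hc']
    simp [Finset.image_image, Function.comp_def]
  have h' := h.relabel σ
  rwa [relabel_relabel_inv] at h'
end

section
/- If 𝒟 is a symmetric (15,8,4)-design of type (C4), then the action of Aut(𝒟) on the point set Fin 15 has exactly two orbits, of sizes 7 and 8, while the action of Aut(𝒟) on the set of blocks (where σ sends a block B to its image σ(B)) has exactly two orbits, of sizes 1 and 14 (one block is fixed by every automorphism and Aut(𝒟) acts transitively on the remaining 14 blocks). -/
/-- A totally symmetric idempotent operation, i.e. a Steiner triple system. -/
structure IsSteiner {ι : Type*} (t : ι → ι → ι) : Prop where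
  idem : ∀ i, t i i = i
  comm : ∀ i j, t i j = t j i
  cancel : ∀ i j, t i (t i j) = j

lemma mem_of_nodup_seven {l : List (Fin 7)} (h : l.Nodup) (hl : l.length = 7) (z : Fin 7) :
    z ∈ l := by
  have : l.toFinset = Finset.univ := by
    rw [← Finset.card_eq_iff_eq_univ, List.toFinset_card_of_nodup h, hl, Fintype.card_fin]
  simpa using this.ge (Finset.mem_univ z)

lemma exists_ne_five (a b c d e : Fin 7) : ∃ z, z ≠ a ∧ z ≠ b ∧ z ≠ c ∧ z ≠ d ∧ z ≠ e := by
  have h : ({a, b, c, d, e} : Finset (Fin 7)).card < (Finset.univ : Finset (Fin 7)).card :=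
    lt_of_le_of_lt Finset.card_le_five (by simp)
  obtain ⟨z, -, hz⟩ := Finset.exists_mem_notMem_of_card_lt_card h
  exact ⟨z, by simpa using hz⟩

/-- Two disjoint perfect matchings `s`, `t` on the six points `≠ o` form a hexagon. -/
lemma exists_hexagon {o a : Fin 7} (ha : a ≠ o) {s t : Fin 7 → Fin 7}
    (hs : ∀ z, s (s z) = z) (ht : ∀ z, t (t z) = z)
    (hs1 : ∀ z, z ≠ o → s z ≠ o ∧ s z ≠ z) (ht1 : ∀ z, z ≠ o → t z ≠ o ∧ t z ≠ z)
    (hst : ∀ z, z ≠ o → s z ≠ t z) :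
    ∃ b c d e f : Fin 7, [o, a, b, c, d, e, f].Nodup ∧
      s a = b ∧ t b = c ∧ s c = d ∧ t d = e ∧ s e = f ∧ t f = a := by
  obtain ⟨b, hb⟩ : ∃ b, s a = b := ⟨_, rfl⟩
  obtain ⟨c, hc⟩ : ∃ c, t b = c := ⟨_, rfl⟩
  obtain ⟨d, hd⟩ : ∃ d, s c = d := ⟨_, rfl⟩
  obtain ⟨e, he⟩ : ∃ e, t d = e := ⟨_, rfl⟩
  obtain ⟨f, hf⟩ : ∃ f, s e = f := ⟨_, rfl⟩
  have h1 : b ≠ o ∧ b ≠ a ∧ s b = a := by grind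
  have h2 : c ≠ o ∧ c ≠ a ∧ c ≠ b ∧ t c = b := by grind
  have h3 : d ≠ o ∧ d ≠ a ∧ d ≠ b ∧ d ≠ c ∧ s d = c := by grind
  have h4 : e ≠ o ∧ e ≠ b ∧ e ≠ c ∧ e ≠ d ∧ t e = d := by grind
  have hea : e ≠ a := by
    intro hea
    obtain ⟨z, hz⟩ := exists_ne_five o a b c d
    have hzs : [o, a, b, c, d, z, s z].Nodup := by
      simp only [List.nodup_cons, List.mem_cons, List.not_mem_nil]; grind
    have := mem_of_nodup_seven hzs rfl (t z)
    simp only [List.mem_cons, List.not_mem_nil] at this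
    grind
  have h5 : f ≠ o ∧ f ≠ a ∧ f ≠ b ∧ f ≠ c ∧ f ≠ d ∧ f ≠ e ∧ s f = e := by grind
  have h6 : [o, a, b, c, d, e, f].Nodup := by
    simp only [List.nodup_cons, List.mem_cons, List.not_mem_nil]; grind
  refine ⟨b, c, d, e, f, h6, hb, hc, hd, he, hf, ?_⟩
  have := mem_of_nodup_seven h6 rfl (t f)
  simp only [List.mem_cons, List.not_mem_nil] at this
  grind

lemma IsSteiner.ne {ι : Type*} {t : ι → ι → ι} (ht : IsSteiner t) {i j : ι} (h : j ≠ i) :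
    t i j ≠ i ∧ t i j ≠ j := by
  constructor <;> intro h'
  · have := ht.cancel i j
    rw [h', ht.idem] at this
    exact h this.symm
  · have := ht.cancel j i
    rw [ht.comm, ht.comm j i, h', ht.idem] at this
    exact h this

lemma IsSteiner.perms {ι : Type*} {t : ι → ι → ι} (ht : IsSteiner t) {i j k : ι}
    (h : t i j = k) : t j i = k ∧ t i k = j ∧ t k i = j ∧ t j k = i ∧ t k j = i := by
  subst h
  have h1 := ht.cancel i j
  have h2 := ht.cancel j i
  rw [ht.comm j i] at h2
  exact ⟨ht.comm _ _, h1, by rw [ht.comm, h1], h2, by rw [ht.comm, h2]⟩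

lemma exists_cyclic_labeling {s t : Fin 7 → Fin 7 → Fin 7} (hs : IsSteiner s) (ht : IsSteiner t)
    (hst : ∀ i j, i ≠ j → s i j ≠ t i j) :
    ∃ x : Fin 7 → Fin 7, Function.Injective x ∧
      ∀ k, s (x k) (x (k + 1)) = x (k + 3) ∧ t (x k) (x (k + 6)) = x (k + 4) := by
  obtain ⟨o, a, ha⟩ : ∃ o a : Fin 7, a ≠ o := ⟨0, 1, by decide⟩
  obtain ⟨b, c, d, e, f, hn, h1, h2, h3, h4, h5, h6⟩ :=
    exists_hexagon ha (hs.cancel o) (ht.cancel o)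
      (fun z hz => hs.ne hz) (fun z hz => ht.ne hz) (fun z hz => hst o z hz.symm)
  have key : ∀ {a b c d e f}, [o, a, b, c, d, e, f].Nodup →
      s o a = b → t o b = c → s o c = d → t o d = e → s o e = f → t o f = a → s a c = e →
      ∃ x : Fin 7 → Fin 7, Function.Injective x ∧
        ∀ k, s (x k) (x (k + 1)) = x (k + 3) ∧ t (x k) (x (k + 6)) = x (k + 4) := by
    intro a b c d e f hn h1 h2 h3 h4 h5 h6 h7
    refine ⟨![o, a, c, b, e, f, d], ?_, ?_⟩
    · rw [← List.nodup_ofFn]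
      simp [List.ofFn_succ] at hn ⊢
      grind
    · have hm := mem_of_nodup_seven hn rfl
      simp only [List.nodup_cons, List.mem_cons, List.not_mem_nil, or_false] at hn hm
      have hsn := fun {i j} => hs.ne (i := i) (j := j)
      have htn := fun {i j} => ht.ne (i := i) (j := j)
      have hsp : ∀ {i j k}, s i j = k → s j i = k ∧ s i k = j ∧ s k i = j ∧ s j k = i ∧ s k j = i :=
        fun h => hs.perms h
      have htp : ∀ {i j k}, t i j = k → t j i = k ∧ t i k = j ∧ t k i = j ∧ t j k = i ∧ t k j = i :=
        fun h => ht.perms h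
      have g1 := hsp h1
      have g2 := htp h2
      have g3 := hsp h3
      have g4 := htp h4
      have g5 := hsp h5
      have g6 := htp h6
      have g7 := hsp h7
      have e1 : s c b = f := by
        have := hm (s c b); have := hsp (rfl : s c b = _); have := hsn (i := c) (j := b); grind
      have k1 := hsp e1
      have e2 : s b e = d := by
        have := hm (s b e); have := hsp (rfl : s b e = _); have := hsn (i := b) (j := e); grind
      have k2 := hsp e2
      have e3 : s f d = a := by
        have := hm (s f d); have := hsp (rfl : s f d = _); have := hsn (i := f) (j := d); grind
      have e4 : t c a = d := by
        have := hm (t c a); have := htp (rfl : t c a = _); have := htn (i := c) (j := a)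
        have := hst a c; grind
      have k4 := htp e4
      have e5 : t a b = e := by
        have := hm (t a b); have := htp (rfl : t a b = _); have := htn (i := a) (j := b); grind
      have k5 := htp e5
      have e6 : t f e = c := by
        have := hm (t f e); have := htp (rfl : t f e = _); have := htn (i := f) (j := e); grind
      have k6 := htp e6
      have e7 : t d f = b := by
        have := hm (t d f); have := htp (rfl : t d f = _); have := htn (i := d) (j := f); grind
      intro k
      fin_cases k
      · exact ⟨h1, h4⟩
      · exact ⟨h7, g6.2.2.1⟩
      · exact ⟨e1, e4⟩
      · exact ⟨e2, g2.2.2.2.1⟩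
      · exact ⟨g5.2.2.2.1, k5.2.2.2.2⟩
      · exact ⟨e3, e6⟩
      · exact ⟨g3.2.2.1, e7⟩
  have hm := mem_of_nodup_seven hn rfl
  simp only [List.mem_cons, List.not_mem_nil, or_false] at hm
  by_cases h7 : s a c = e
  · exact key hn h1 h2 h3 h4 h5 h6 h7
  · refine key (a := b) (b := a) (c := f) (d := e) (e := d) (f := c) ?_ (hs.perms h1).2.1
      (ht.perms h6).2.1 (hs.perms h5).2.1 (ht.perms h4).2.1 (hs.perms h3).2.1 (ht.perms h2).2.1 ?_
    · simp only [List.nodup_cons, List.mem_cons, List.not_mem_nil] at hn ⊢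
      grind
    · simp only [List.nodup_cons, List.mem_cons, List.not_mem_nil] at hn
      have hsn := fun {i j} => hs.ne (i := i) (j := j)
      have hsp : ∀ {i j k}, s i j = k → s j i = k ∧ s i k = j ∧ s k i = j ∧ s j k = i ∧ s k j = i :=
        fun h => hs.perms h
      have g1 := hsp h1
      have g3 := hsp h3
      have g5 := hsp h5
      have e1 : s a c = f := by
        have := hm (s a c); have := hsp (rfl : s a c = _); have := hsn (i := a) (j := c); grind
      have k1 := hsp e1
      have e2 : s a e = d := by
        have := hm (s a e); have := hsp (rfl : s a e = _); have := hsn (i := a) (j := e); grind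
      have k2 := hsp e2
      have := hm (s b f); have := hsp (rfl : s b f = _); have := hsn (i := b) (j := f); grind

/-- Seven triples in a seven-set, any two meeting in one point: a Fano plane. -/
structure IsFano {α : Type*} [DecidableEq α] (X : Finset α) (G : Fin 7 → Finset α) : Prop where
  card_points : X.card = 7
  subset : ∀ i, G i ⊆ X
  card : ∀ i, (G i).card = 3
  inter : ∀ i j, i ≠ j → (G i ∩ G j).card = 1

namespace IsFano

variable {α : Type*} [DecidableEq α] {X : Finset α} {G : Fin 7 → Finset α}

lemma sum_indicator_mul (h : IsFano X G) (i j : Fin 7) :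
    ∑ x ∈ X, (if x ∈ G i then 1 else 0 : ℤ) * (if x ∈ G j then 1 else 0) =
      if i = j then 3 else 1 := by
  have : ∑ x ∈ X, (if x ∈ G i then 1 else 0 : ℤ) * (if x ∈ G j then 1 else 0) =
      (G i ∩ G j).card := by
    simp only [← ite_and, mul_ite, mul_one, mul_zero, Finset.sum_boole]
    congr 2
    ext x
    have := h.subset i (x := x)
    simp only [Finset.mem_filter, Finset.mem_inter]
    tauto
  rw [this]
  split_ifs with hij
  · subst hij; simp [h.card]
  · simp [h.inter i j hij]

lemma sum_indicator (h : IsFano X G) (i : Fin 7) :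
    ∑ x ∈ X, (if x ∈ G i then 1 else 0 : ℤ) = 3 := by
  simpa using h.sum_indicator_mul i i

lemma degree (h : IsFano X G) {x : α} (hx : x ∈ X) :
    (Finset.univ.filter fun i => x ∈ G i).card = 3 := by
  have key : ∑ x ∈ X, ((∑ i, if x ∈ G i then 1 else 0 : ℤ) - 3) ^ 2 = 0 := by
    have e : ∀ x, ((∑ i, if x ∈ G i then 1 else 0 : ℤ) - 3) ^ 2 =
        ∑ i, ∑ j, (if x ∈ G i then 1 else 0 : ℤ) * (if x ∈ G j then 1 else 0) -
          6 * ∑ i, (if x ∈ G i then 1 else 0 : ℤ) + 9 := by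
      intro x
      rw [← Finset.sum_mul_sum]; ring
    have e' : ∑ x ∈ X, ∑ i, ∑ j, (if x ∈ G i then 1 else 0 : ℤ) * (if x ∈ G j then 1 else 0) =
        ∑ i : Fin 7, ∑ j : Fin 7, if i = j then 3 else 1 := by
      rw [Finset.sum_comm]
      refine Finset.sum_congr rfl fun i _ => ?_
      rw [Finset.sum_comm]
      exact Finset.sum_congr rfl fun j _ => h.sum_indicator_mul i j
    have e'' : ∑ x ∈ X, ∑ i, (if x ∈ G i then 1 else 0 : ℤ) = 21 := by
      rw [Finset.sum_comm]
      simp only [h.sum_indicator]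
      rfl
    rw [Finset.sum_congr rfl fun x _ => e x, Finset.sum_add_distrib, Finset.sum_sub_distrib,
      e', ← Finset.mul_sum, e'', Finset.sum_const, h.card_points]
    decide
  have := (Finset.sum_eq_zero_iff_of_nonneg fun _ _ => sq_nonneg _).1 key x hx
  have := pow_eq_zero_iff (two_ne_zero) |>.1 this
  rw [Finset.sum_boole] at this
  have h3 : ((Finset.univ.filter fun i => x ∈ G i).card : ℤ) = 3 := by linarith
  exact_mod_cast h3

lemma injective (h : IsFano X G) : Function.Injective G := by
  intro i j hij
  by_contra hne
  have := h.inter i j hne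
  rw [hij, Finset.inter_self, h.card] at this
  omega

lemma exists_third (h : IsFano X G) {i j : Fin 7} (hij : i ≠ j) :
    ∃ k, k ≠ i ∧ k ≠ j ∧ ∀ x ∈ X, (x ∈ G k ↔ (x ∈ G i ↔ x ∈ G j)) := by
  obtain ⟨p, hp⟩ := Finset.card_eq_one.1 (h.inter i j hij)
  have hp' : p ∈ G i ∩ G j := by simp [hp]
  rw [Finset.mem_inter] at hp'
  have hpX := h.subset i hp'.1
  have hlt : ({i, j} : Finset (Fin 7)).card < (Finset.univ.filter fun i => p ∈ G i).card := by
    rw [h.degree hpX]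
    exact lt_of_le_of_lt Finset.card_le_two (by norm_num)
  obtain ⟨k, hk, hk'⟩ := Finset.exists_mem_notMem_of_card_lt_card hlt
  simp only [Finset.mem_insert, Finset.mem_singleton, not_or, Finset.mem_filter,
    Finset.mem_univ, true_and] at hk hk'
  refine ⟨k, hk'.1, hk'.2, ?_⟩
  have key : ∑ x ∈ X, ((if x ∈ G i then 1 else 0) + (if x ∈ G j then 1 else 0) +
      (if x ∈ G k then 1 else 0) - 1 : ℤ) ^ 2 = 4 := by
    have e : ∀ x, ((if x ∈ G i then 1 else 0) + (if x ∈ G j then 1 else 0) +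
      (if x ∈ G k then 1 else 0) - 1 : ℤ) ^ 2 =
        - (if x ∈ G i then 1 else 0) - (if x ∈ G j then 1 else 0) - (if x ∈ G k then 1 else 0)
        + 2 * ((if x ∈ G i then 1 else 0) * (if x ∈ G j then 1 else 0)) +
        2 * ((if x ∈ G i then 1 else 0) * (if x ∈ G k then 1 else 0)) +
        2 * ((if x ∈ G j then 1 else 0) * (if x ∈ G k then 1 else 0)) + 1 := by
      intro x; split_ifs <;> norm_num
    simp only [e, Finset.sum_add_distrib, Finset.sum_sub_distrib, Finset.sum_neg_distrib,
      ← Finset.mul_sum, h.sum_indicator, h.sum_indicator_mul]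
    simp [h.card_points, hij, Ne.symm hk'.1, Ne.symm hk'.2]
  rw [← Finset.add_sum_erase X _ hpX] at key
  simp only [hp', hk, if_true] at key
  have key' : ∑ x ∈ X.erase p, ((if x ∈ G i then 1 else 0) + (if x ∈ G j then 1 else 0) +
      (if x ∈ G k then 1 else 0) - 1 : ℤ) ^ 2 = 0 := by linarith
  intro x hx
  by_cases hxp : x = p
  · subst hxp; tauto
  have := (Finset.sum_eq_zero_iff_of_nonneg fun _ _ => sq_nonneg _).1 key' x
    (Finset.mem_erase.2 ⟨hxp, hx⟩)
  by_cases x ∈ G i <;> by_cases x ∈ G j <;> by_cases x ∈ G k <;> simp_all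

lemma eq_of_mem_iff (h : IsFano X G) {i j : Fin 7} (hij : ∀ x ∈ X, (x ∈ G i ↔ x ∈ G j)) :
    i = j := by
  apply h.injective
  ext x
  exact ⟨fun hx => (hij x (h.subset i hx)).1 hx, fun hx => (hij x (h.subset j hx)).2 hx⟩

lemma exists_isSteiner (h : IsFano X G) : ∃ t : Fin 7 → Fin 7 → Fin 7, IsSteiner t ∧
    ∀ i j, i ≠ j → ∀ x ∈ X, (x ∈ G (t i j) ↔ (x ∈ G i ↔ x ∈ G j)) := by
  have ex : ∀ i j, ∃ k, (i = j → k = i) ∧ (i ≠ j → k ≠ i ∧ k ≠ j ∧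
      ∀ x ∈ X, (x ∈ G k ↔ (x ∈ G i ↔ x ∈ G j))) := by
    intro i j
    by_cases hij : i = j
    · exact ⟨i, by simp [hij]⟩
    · obtain ⟨k, hk⟩ := h.exists_third hij
      exact ⟨k, by simp [hij], fun _ => hk⟩
  choose t ht ht' using ex
  refine ⟨t, ⟨fun i => ht i i rfl, fun i j => ?_, fun i j => ?_⟩, fun i j hij => (ht' i j hij).2.2⟩
  · by_cases hij : i = j
    · rw [hij]
    · refine h.eq_of_mem_iff fun x hx => ?_
      rw [(ht' i j hij).2.2 x hx, (ht' j i (Ne.symm hij)).2.2 x hx]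
      exact iff_comm
  · by_cases hij : i = j
    · rw [ht i j hij, ht i i rfl, hij]
    · refine h.eq_of_mem_iff fun x hx => ?_
      rw [(ht' i _ (ht' i j hij).1.symm).2.2 x hx, (ht' i j hij).2.2 x hx]
      by_cases x ∈ G i <;> by_cases x ∈ G j <;> simp_all

/-- The points of a Fano plane whose lines contain the translates of `{0, u, v}`. -/
lemma exists_points (h : IsFano X G) {u v : Fin 7}
    (huv : ∀ k, k ≠ k + u ∧ k ≠ k + v ∧ k + u ≠ k + v)
    (hinj : ∀ k l : Fin 7, ({k, k + u, k + v} : Finset (Fin 7)) = {l, l + u, l + v} → k = l)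
    (hG : ∀ k, ∀ x ∈ X, x ∈ G k → x ∈ G (k + u) → x ∈ G (k + v)) :
    ∃ p : Fin 7 → α, Function.Injective p ∧ (∀ k, p k ∈ X) ∧
      ∀ k i, p k ∈ G i ↔ i = k ∨ i = k + u ∨ i = k + v := by
  have ex : ∀ k, ∃ p, p ∈ X ∧ ∀ i, p ∈ G i ↔ i = k ∨ i = k + u ∨ i = k + v := by
    intro k
    obtain ⟨p, hp⟩ := Finset.card_eq_one.1 (h.inter k (k + u) (huv k).1)
    have hp' : p ∈ G k ∩ G (k + u) := by simp [hp]
    rw [Finset.mem_inter] at hp'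
    have hpX := h.subset _ hp'.1
    have h3 : p ∈ G (k + v) := hG k p hpX hp'.1 hp'.2
    refine ⟨p, hpX, fun i => ?_⟩
    have : ({k, k + u, k + v} : Finset (Fin 7)) = Finset.univ.filter fun i => p ∈ G i := by
      apply Finset.eq_of_subset_of_card_le
      · intro i hi
        simp only [Finset.mem_insert, Finset.mem_singleton] at hi
        rcases hi with rfl | rfl | rfl <;> simp [hp', h3]
      · rw [h.degree hpX, Finset.card_eq_three.2 ⟨_, _, _, (huv k).1, (huv k).2.1, (huv k).2.2, rfl⟩]
    have := Finset.ext_iff.1 this i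
    simpa using this.symm
  choose p hpX hp using ex
  refine ⟨p, fun k l hkl => hinj k l ?_, hpX, hp⟩
  ext i
  have h1 := hp k i
  rw [hkl, hp l i] at h1
  simpa using h1.symm

end IsFano

lemma IsCenter.card_inter {B : Finset (Finset (Fin 15))} {O : Finset (Fin 15)} (hD : IsDesign B)
    (hO : IsCenter B O) {b : Finset (Fin 15)} (hb : b ∈ B) (hbO : b ≠ O) :
    (O ∩ b).card = 4 :=
  hD.2.2 O hO.1 b hb hbO.symm

lemma IsCenter.card_inter_inter {B : Finset (Finset (Fin 15))} {O : Finset (Fin 15)}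
    (hD : IsDesign B) (hO : IsCenter B O) {b c : Finset (Fin 15)} (hb : b ∈ B) (hbO : b ≠ O)
    (hc : c ∈ B) (hcO : c ≠ O) (hbc : b ≠ c) (hbc' : b ≠ symmDiff O c) :
    (O ∩ b ∩ c).card = 2 ∧ ((b ∩ c) \ O).card = 2 := by
  have h1 := hD.2.2 b hb c hc hbc
  have h2 := hD.2.2 b hb _ (hO.2 c hc hcO) hbc'
  have h3 := hO.card_inter hD hb hbO
  have e1 := Finset.card_inter_add_card_sdiff (b ∩ c) O
  have e2 := Finset.card_inter_add_card_sdiff (b ∩ symmDiff O c) O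
  have e3 := Finset.card_inter_add_card_sdiff (O ∩ b) c
  have f1 : b ∩ c ∩ O = O ∩ b ∩ c := by ext; simp; tauto
  have f2 : b ∩ symmDiff O c ∩ O = (O ∩ b) \ c := by
    ext; simp [Finset.mem_symmDiff]; tauto
  have f3 : (b ∩ symmDiff O c) \ O = (b ∩ c) \ O := by
    ext; simp [Finset.mem_symmDiff]; tauto
  rw [f1] at e1
  rw [f2, f3] at e2
  omega

/-- The blocks other than `O` through a point `o` of the center, enumerated. -/
structure IsEnum (B : Finset (Finset (Fin 15))) (O : Finset (Fin 15)) (o : Fin 15)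
    (β : Fin 7 → Finset (Fin 15)) : Prop where
  injective : Function.Injective β
  mem : ∀ i, β i ∈ B
  ne : ∀ i, β i ≠ O
  base_mem : ∀ i, o ∈ β i
  eq : ∀ b ∈ B, b ≠ O → ∃ i, b = β i ∨ b = symmDiff O (β i)

lemma IsCenter.exists_isEnum {B : Finset (Finset (Fin 15))} {O : Finset (Fin 15)}
    (hD : IsDesign B) (hO : IsCenter B O) {o : Fin 15} (ho : o ∈ O) :
    ∃ β, IsEnum B O o β := by
  set P := (B.erase O).filter (o ∈ ·) with hP
  have hne : ∀ b, b.card = 8 → b ≠ O → symmDiff O b ≠ O := by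
    rintro b hb - h
    rw [symmDiff_eq_left] at h
    simp [h] at hb
  have hcard : P.card = 7 := by
    have h1 : P.card + ((B.erase O).filter (¬ o ∈ ·)).card = 14 := by
      rw [hP, Finset.card_filter_add_card_filter_not, Finset.card_erase_of_mem hO.1, hD.1]
    have h2 : P.card = ((B.erase O).filter (¬ o ∈ ·)).card := by
      refine Finset.card_bij' (fun b _ => symmDiff O b) (fun b _ => symmDiff O b) ?_ ?_ ?_ ?_
      · intro b hb
        simp only [hP, Finset.mem_filter, Finset.mem_erase] at hb ⊢
        refine ⟨⟨hne b (hD.2.1 b hb.1.2) hb.1.1, hO.2 b hb.1.2 hb.1.1⟩, ?_⟩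
        simp [Finset.mem_symmDiff, ho, hb.2]
      · intro b hb
        simp only [hP, Finset.mem_filter, Finset.mem_erase] at hb ⊢
        refine ⟨⟨hne b (hD.2.1 b hb.1.2) hb.1.1, hO.2 b hb.1.2 hb.1.1⟩, ?_⟩
        simp [Finset.mem_symmDiff, ho, hb.2]
      · intro b _; simp
      · intro b _; simp
    omega
  have e : Fin 7 ≃ P := (P.equivFinOfCardEq hcard).symm
  have he : ∀ i, (e i : Finset (Fin 15)) ∈ P := fun i => (e i).2
  simp only [hP, Finset.mem_filter, Finset.mem_erase] at he
  refine ⟨fun i => e i, fun i j hij => e.injective (Subtype.ext hij), fun i => (he i).1.2,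
    fun i => (he i).1.1, fun i => (he i).2, fun b hb hbO => ?_⟩
  by_cases hob : o ∈ b
  · have hbP : b ∈ P := by simp [hP, hb, hbO, hob]
    exact ⟨e.symm ⟨b, hbP⟩, by simp⟩
  · have hbP : symmDiff O b ∈ P := by
      simp [hP, hO.2 b hb hbO, hne b (hD.2.1 b hb) hbO, hob, ho, Finset.mem_symmDiff]
    exact ⟨e.symm ⟨_, hbP⟩, by simp⟩

namespace IsEnum

variable {B : Finset (Finset (Fin 15))} {O : Finset (Fin 15)} {o : Fin 15}
  {β : Fin 7 → Finset (Fin 15)}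

lemma comp (h : IsEnum B O o β) {e : Fin 7 → Fin 7} (he : Function.Injective e) :
    IsEnum B O o (β ∘ e) where
  injective := h.injective.comp he
  mem _ := h.mem _
  ne _ := h.ne _
  base_mem _ := h.base_mem _
  eq b hb hbO := by
    obtain ⟨i, hi⟩ := h.eq b hb hbO
    obtain ⟨j, rfl⟩ := (Finite.injective_iff_surjective.1 he) i
    exact ⟨j, hi⟩

lemma card_inter_inter (h : IsEnum B O o β) (hD : IsDesign B) (hO : IsCenter B O) (ho : o ∈ O)
    {i j : Fin 7} (hij : i ≠ j) :
    (O ∩ β i ∩ β j).card = 2 ∧ ((β i ∩ β j) \ O).card = 2 := by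
  refine hO.card_inter_inter hD (h.mem i) (h.ne i) (h.mem j) (h.ne j) (h.injective.ne hij) ?_
  intro h'
  have := h.base_mem i
  rw [h', Finset.mem_symmDiff] at this
  simp [ho, h.base_mem j] at this

lemma isFano_inside (h : IsEnum B O o β) (hD : IsDesign B) (hO : IsCenter B O) (ho : o ∈ O) :
    IsFano (O.erase o) fun i => (O ∩ β i).erase o where
  card_points := by rw [Finset.card_erase_of_mem ho, hD.2.1 O hO.1]
  subset i := Finset.erase_subset_erase _ Finset.inter_subset_left
  card i := by
    rw [Finset.card_erase_of_mem (by simp [ho, h.base_mem]), hO.card_inter hD (h.mem i) (h.ne i)]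
  inter i j hij := by
    have : (O ∩ β i).erase o ∩ (O ∩ β j).erase o = (O ∩ β i ∩ β j).erase o := by
      ext; simp; tauto
    rw [this, Finset.card_erase_of_mem (by simp [ho, h.base_mem]),
      (h.card_inter_inter hD hO ho hij).1]

lemma isFano_outside (h : IsEnum B O o β) (hD : IsDesign B) (hO : IsCenter B O) (ho : o ∈ O) :
    IsFano Oᶜ fun i => (O ∪ β i)ᶜ := by
  have hO8 := hD.2.1 O hO.1
  refine ⟨?_, fun i => ?_, fun i => ?_, fun i j hij => ?_⟩
  · rw [Finset.card_compl, hO8]; rfl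
  · exact Finset.compl_subset_compl.2 Finset.subset_union_left
  · have h1 := Finset.card_union_add_card_inter O (β i)
    rw [hO.card_inter hD (h.mem i) (h.ne i), hO8, hD.2.1 _ (h.mem i)] at h1
    rw [Finset.card_compl, Fintype.card_fin]
    omega
  · rw [← Finset.compl_union, Finset.card_compl, Fintype.card_fin]
    have e1 := Finset.card_union_add_card_inter (O ∪ β i) (O ∪ β j)
    have e2 := Finset.card_union_add_card_inter O (β i)
    have e3 := Finset.card_union_add_card_inter O (β j)
    rw [hO.card_inter hD (h.mem i) (h.ne i), hO8, hD.2.1 _ (h.mem i)] at e2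
    rw [hO.card_inter hD (h.mem j) (h.ne j), hO8, hD.2.1 _ (h.mem j)] at e3
    have e4 : ((O ∪ β i) ∩ (O ∪ β j)).card = 10 := by
      rw [← Finset.union_inter_distrib_left, ← Finset.union_sdiff_self_eq_union,
        Finset.card_union_of_disjoint Finset.disjoint_sdiff, hO8,
        (h.card_inter_inter hD hO ho hij).2]
    omega

end IsEnum

/-- Incidence of the blocks through the base point `none` in the model design. The point `inl k`
of the center lies on the blocks indexed by the difference set translate `{k, k + 1, k + 3}`, the
point `inr k` off the center on those not indexed by `{k, k - 1, k - 3}`. -/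
def ModelMem (i : Fin 7) : Option (Fin 7 ⊕ Fin 7) → Prop
  | none => True
  | some (.inl k) => i = k ∨ i = k + 1 ∨ i = k + 3
  | some (.inr k) => ¬ (i = k ∨ i = k + 6 ∨ i = k + 4)

/-- The points of the central block of the model design. -/
def ModelCenter : Option (Fin 7 ⊕ Fin 7) → Prop
  | some (.inr _) => False
  | _ => True

/-- An identification of the design `B` with the model design. -/
structure IsLabeling (B : Finset (Finset (Fin 15))) (O : Finset (Fin 15)) (o : Fin 15)
    (β : Fin 7 → Finset (Fin 15)) (e : Option (Fin 7 ⊕ Fin 7) ≃ Fin 15) : Prop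
    extends IsEnum B O o β where
  base : e none = o
  mem_center : ∀ x, e x ∈ O ↔ ModelCenter x
  mem_block : ∀ i x, e x ∈ β i ↔ ModelMem i x

lemma exists_isLabeling {B : Finset (Finset (Fin 15))} {O : Finset (Fin 15)} (hD : IsDesign B)
    (hO : IsCenter B O) (hline : ∀ l, IsLineIn B l → O ∈ l) {o : Fin 15} (ho : o ∈ O) :
    ∃ β e, IsLabeling B O o β e := by
  obtain ⟨β, h⟩ := hO.exists_isEnum hD ho
  obtain ⟨s, hs, hsG⟩ := (h.isFano_inside hD hO ho).exists_isSteiner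
  obtain ⟨t, ht, htG⟩ := (h.isFano_outside hD hO ho).exists_isSteiner
  have hst : ∀ i j, i ≠ j → s i j ≠ t i j := by
    intro i j hij hk
    have hs' := hsG i j hij
    have ht' := htG i j hij
    rw [← hk] at ht'
    set k := s i j
    have heq : symmDiff (β i) (β j) = symmDiff O (β k) := by
      ext x
      have h1 := hs' x
      have h2 := ht' x
      simp only [Finset.mem_erase, Finset.mem_inter, Finset.mem_compl, Finset.mem_union] at h1 h2
      simp only [Finset.mem_symmDiff]
      clear hs' ht' hsG htG
      by_cases hxo : x = o
      · subst hxo; simp [ho, h.base_mem]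
      · by_cases x ∈ O <;> by_cases x ∈ β i <;> by_cases x ∈ β j <;> by_cases x ∈ β k <;> simp_all
    have := hline _ ⟨β i, h.mem i, β j, h.mem j, h.injective.ne hij,
      heq ▸ hO.2 _ (h.mem k) (h.ne k), rfl⟩
    simp only [Set.mem_insert_iff, Set.mem_singleton_iff, heq] at this
    rcases this with h' | h' | h'
    · exact h.ne i h'.symm
    · exact h.ne j h'.symm
    · rw [eq_comm, symmDiff_eq_left] at h'
      have := h.base_mem k
      simp [h'] at this
  obtain ⟨x, hx, hxst⟩ := exists_cyclic_labeling hs ht hst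
  have h' := h.comp hx
  have hk1 : ∀ k : Fin 7, k ≠ k + 1 := by decide
  have hk6 : ∀ k : Fin 7, k ≠ k + 6 := by decide
  obtain ⟨p, hp, hpX, hpG⟩ := (h'.isFano_inside hD hO ho).exists_points (u := 1) (v := 3)
    (by decide) (by decide) fun k y hy h1 h2 => by
      have := (hsG (x k) (x (k + 1)) (hx.ne (hk1 k)) y hy).2 (iff_of_true h1 h2)
      rwa [(hxst k).1] at this
  obtain ⟨q, hq, hqX, hqG⟩ := (h'.isFano_outside hD hO ho).exists_points (u := 6) (v := 4)
    (by decide) (by decide) fun k y hy h1 h2 => by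
      have := (htG (x k) (x (k + 6)) (hx.ne (hk6 k)) y hy).2 (iff_of_true h1 h2)
      rwa [(hxst k).2] at this
  simp only [Finset.mem_erase, Finset.mem_compl] at hpX hqX
  let f : Option (Fin 7 ⊕ Fin 7) → Fin 15 := fun y => y.elim o (Sum.elim p q)
  have hf : Function.Injective f := by
    rintro (_ | k | k) (_ | l | l) hkl <;>
      simp only [f, Option.elim, Sum.elim_inl, Sum.elim_inr] at hkl
    · rfl
    · exact absurd hkl.symm (hpX l).1
    · exact absurd ho (hkl ▸ hqX l)
    · exact absurd hkl (hpX k).1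
    · rw [hp hkl]
    · exact absurd (hpX k).2 (hkl ▸ hqX l)
    · exact absurd ho (hkl ▸ hqX k)
    · exact absurd (hpX l).2 (hkl ▸ hqX k)
    · rw [hq hkl]
  have hbij := (Fintype.bijective_iff_injective_and_card f).2 ⟨hf, by simp⟩
  refine ⟨β ∘ x, Equiv.ofBijective f hbij, h', rfl, ?_, ?_⟩
  · rintro (_ | k | k)
    · simpa [f, ModelCenter] using ho
    · simpa [f, ModelCenter] using (hpX k).2
    · simpa [f, ModelCenter] using hqX k
  · rintro i (_ | k | k)
    · simpa [f, ModelMem] using h.base_mem _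
    · have := hpG k i
      simp only [Finset.mem_erase, Finset.mem_inter, hpX, true_and, ne_eq, not_false_eq_true] at this
      exact this
    · have := hqG k i
      simp only [Finset.mem_compl, Finset.mem_union, hqX, false_or] at this
      exact not_iff_comm.1 this |>.symm

/-- The cyclic shift of the points of the model design. -/
def modelShift (s : Fin 7) : Option (Fin 7 ⊕ Fin 7) ≃ Option (Fin 7 ⊕ Fin 7) :=
  Equiv.optionCongr (Equiv.sumCongr (Equiv.addRight s) (Equiv.addRight s))

lemma modelCenter_modelShift (s : Fin 7) (x : Option (Fin 7 ⊕ Fin 7)) :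
    ModelCenter (modelShift s x) ↔ ModelCenter x := by
  rcases x with _ | k | k <;> rfl

lemma modelMem_modelShift (s i : Fin 7) (x : Option (Fin 7 ⊕ Fin 7)) :
    ModelMem (i + s) (modelShift s x) ↔ ModelMem i x := by
  rcases x with _ | k | k
  · rfl
  · simp [modelShift, ModelMem, add_right_comm k s]
  · simp [modelShift, ModelMem, add_right_comm k s]

namespace IsLabeling

variable {B : Finset (Finset (Fin 15))} {O : Finset (Fin 15)} {o o' : Fin 15}
  {β β' : Fin 7 → Finset (Fin 15)} {e e' : Option (Fin 7 ⊕ Fin 7) ≃ Fin 15}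

/-- Two labelings differ by an automorphism of the design. -/
lemma exists_aut (h : IsLabeling B O o β e) (h' : IsLabeling B O o' β' e') (hO : IsCenter B O)
    (s : Fin 7) : ∃ σ ∈ designAut B, (∀ x, σ (e x) = e' (modelShift s x)) ∧
      ∀ i, (β i).image σ = β' (i + s) := by
  set σ : Equiv.Perm (Fin 15) := (e.symm.trans (modelShift s)).trans e' with hσ
  have hσe : ∀ x, σ (e x) = e' (modelShift s x) := by simp [hσ]
  have image_eq : ∀ b c : Finset (Fin 15), (∀ x, e x ∈ b ↔ e' (modelShift s x) ∈ c) →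
      b.image σ = c := by
    intro b c hbc
    ext y
    obtain ⟨x, rfl⟩ := σ.surjective y
    obtain ⟨x, rfl⟩ := e.surjective x
    rw [σ.injective.mem_finset_image, hσe, hbc]
  have h1 : O.image σ = O := image_eq _ _ fun x => by
    rw [h.mem_center, h'.mem_center, modelCenter_modelShift]
  have h2 : ∀ i, (β i).image σ = β' (i + s) := fun i => image_eq _ _ fun x => by
    rw [h.mem_block, h'.mem_block, modelMem_modelShift]
  refine ⟨σ, ?_, hσe, h2⟩
  intro b hb
  by_cases hbO : b = O
  · rw [hbO, h1]; exact hO.1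
  · obtain ⟨i, rfl | rfl⟩ := h.eq b hb hbO
    · rw [h2]; exact h'.mem _
    · rw [Finset.image_symmDiff _ _ σ.injective, h1, h2]
      exact hO.2 _ (h'.mem _) (h'.ne _)

lemma exists_off_center (h : IsLabeling B O o β e) {x : Fin 15} (hx : x ∉ O) :
    ∃ k, x = e (some (.inr k)) := by
  obtain ⟨y, rfl⟩ := e.surjective x
  rw [h.mem_center] at hx
  rcases y with _ | k | k
  · exact absurd trivial hx
  · exact absurd trivial hx
  · exact ⟨k, rfl⟩

lemma exists_block (h : IsLabeling B O o β e) (ho : o ∈ O) {b : Finset (Fin 15)} (hb : b ∈ B)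
    (hbO : b ≠ O) (hob : o ∈ b) : ∃ i, b = β i := by
  obtain ⟨i, rfl | rfl⟩ := h.eq b hb hbO
  · exact ⟨i, rfl⟩
  · simp [Finset.mem_symmDiff, ho, h.base_mem] at hob

end IsLabeling

/-- An automorphism of a design maps center points to center points. -/
lemma IsCenter.image {B : Finset (Finset (Fin 15))} {O : Finset (Fin 15)} (hO : IsCenter B O)
    {σ : Equiv.Perm (Fin 15)} (hσ : σ ∈ designAut B) : IsCenter B (O.image σ) := by
  refine ⟨hσ O hO.1, fun b hb hbO => ?_⟩
  obtain ⟨c, hc, rfl⟩ : ∃ c ∈ B, c.image σ = b := by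
    refine ⟨b.image ⇑σ⁻¹, (designAut B).inv_mem hσ b hb, ?_⟩
    rw [Finset.image_image, ← Equiv.Perm.coe_mul, mul_inv_cancel, Equiv.Perm.coe_one,
      Finset.image_id]
  rw [← Finset.image_symmDiff _ _ σ.injective]
  exact hσ _ (hO.2 c hc fun h => hbO (h ▸ rfl))

/-- for a design of type (C4), the action of `Aut(𝒟)` on points has
exactly two orbits of sizes 7 and 8, and the action on blocks has exactly two orbits of
sizes 1 and 14. -/
theorem stmt16 (B : Finset (Finset (Fin 15))) (hD : IsDesign B)
    (hC4 : ∃ O, IsCenter B O ∧ (∀ O', IsCenter B O' → O' = O) ∧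
      ∀ l, IsLineIn B l → O ∈ l) :
    (∃ S₁ S₂ : Set (Fin 15),
      {S | ∃ x : Fin 15, S = pointOrbit B x} = {S₁, S₂} ∧
      S₁.ncard = 7 ∧ S₂.ncard = 8) ∧
    (∃ T₁ T₂ : Set (Finset (Fin 15)),
      {T | ∃ b ∈ B, T = blockOrbit B b} = {T₁, T₂} ∧
      T₁.ncard = 1 ∧ T₂.ncard = 14) := by
  obtain ⟨O, hO, huniq, hline⟩ := hC4
  have hfix : ∀ σ ∈ designAut B, O.image σ = O := fun σ hσ => huniq _ (hO.image hσ)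
  have hfix' : ∀ σ ∈ designAut B, ∀ x, σ x ∈ O ↔ x ∈ O := by
    intro σ hσ x
    conv_lhs => rw [← hfix σ hσ]
    exact σ.injective.mem_finset_image
  have hlab := fun {o : Fin 15} (ho : o ∈ O) => exists_isLabeling hD hO hline ho
  have hO8 := hD.2.1 O hO.1
  obtain ⟨o, ho⟩ : O.Nonempty := Finset.card_pos.1 (by omega)
  have orb_in : ∀ x ∈ O, pointOrbit B x = O := by
    intro x hx
    ext y
    constructor
    · rintro ⟨σ, hσ, rfl⟩
      exact (hfix' σ hσ x).2 hx
    · intro hy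
      obtain ⟨β, e, h⟩ := hlab hx
      obtain ⟨β', e', h'⟩ := hlab hy
      obtain ⟨σ, hσ, hσe, -⟩ := h.exists_aut h' hO 0
      refine ⟨σ, hσ, ?_⟩
      have := hσe none
      rw [h.base] at this
      rw [this]
      exact h'.base.symm
  have orb_out : ∀ x ∉ O, pointOrbit B x = (Oᶜ : Finset (Fin 15)) := by
    intro x hx
    ext y
    rw [Finset.mem_coe, Finset.mem_compl]
    constructor
    · rintro ⟨σ, hσ, rfl⟩
      rwa [hfix' σ hσ x]
    · intro hy
      obtain ⟨β, e, h⟩ := hlab ho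
      obtain ⟨k, rfl⟩ := h.exists_off_center hx
      obtain ⟨l, rfl⟩ := h.exists_off_center hy
      obtain ⟨σ, hσ, hσe, -⟩ := h.exists_aut h hO (l - k)
      refine ⟨σ, hσ, ?_⟩
      rw [hσe]
      simp [modelShift]
  have orb_center : blockOrbit B O = {O} := by
    ext b
    constructor
    · rintro ⟨σ, hσ, rfl⟩
      exact hfix σ hσ
    · rintro rfl
      exact ⟨1, (designAut B).one_mem, by simp⟩
  have orb_block : ∀ b ∈ B, b ≠ O → blockOrbit B b = (B.erase O : Finset _) := by
    have meets : ∀ b ∈ B, b ≠ O → ∃ p ∈ O, p ∈ b := by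
      intro b hb hbO
      obtain ⟨p, hp⟩ : (O ∩ b).Nonempty :=
        Finset.card_pos.1 (by rw [hO.card_inter hD hb hbO]; norm_num)
      exact ⟨p, Finset.mem_inter.1 hp⟩
    intro b hb hbO
    ext c
    rw [Finset.mem_coe, Finset.mem_erase]
    constructor
    · rintro ⟨σ, hσ, rfl⟩
      refine ⟨fun h => hbO ?_, hσ b hb⟩
      rw [← hfix σ hσ] at h
      exact Finset.image_injective σ.injective h
    · rintro ⟨hcO, hc⟩
      obtain ⟨p, hpO, hpb⟩ := meets b hb hbO
      obtain ⟨q, hqO, hqc⟩ := meets c hc hcO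
      obtain ⟨β, e, h⟩ := hlab hpO
      obtain ⟨β', e', h'⟩ := hlab hqO
      obtain ⟨i, rfl⟩ := h.exists_block hpO hb hbO hpb
      obtain ⟨j, rfl⟩ := h'.exists_block hqO hc hcO hqc
      obtain ⟨σ, hσ, -, hσβ⟩ := h.exists_aut h' hO (j - i)
      exact ⟨σ, hσ, by rw [hσβ, add_sub_cancel]⟩
  have hOc7 : (Oᶜ).card = 7 := by rw [Finset.card_compl, hO8]; rfl
  obtain ⟨z, hz⟩ : (Oᶜ).Nonempty := Finset.card_pos.1 (by omega)
  have hB14 : (B.erase O).card = 14 := by rw [Finset.card_erase_of_mem hO.1, hD.1]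
  obtain ⟨b, hb⟩ : (B.erase O).Nonempty := Finset.card_pos.1 (by omega)
  rw [Finset.mem_compl] at hz
  rw [Finset.mem_erase] at hb
  refine ⟨⟨(Oᶜ : Finset (Fin 15)), O, ?_, ?_, ?_⟩, ⟨{O}, (B.erase O : Finset _), ?_, ?_, ?_⟩⟩
  · ext S
    constructor
    · rintro ⟨x, rfl⟩
      by_cases hx : x ∈ O
      · exact Or.inr (orb_in x hx)
      · exact Or.inl (orb_out x hx)
    · rintro (rfl | rfl)
      · exact ⟨z, (orb_out z hz).symm⟩
      · exact ⟨o, (orb_in o ho).symm⟩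
  · rw [Set.ncard_coe_finset, hOc7]
  · rw [Set.ncard_coe_finset, hO8]
  · ext T
    constructor
    · rintro ⟨c, hc, rfl⟩
      by_cases hcO : c = O
      · exact Or.inl (hcO ▸ orb_center)
      · exact Or.inr (orb_block c hc hcO)
    · rintro (rfl | rfl)
      · exact ⟨O, hO.1, orb_center.symm⟩
      · exact ⟨b, hb.2, (orb_block b hb.2 hb.1).symm⟩
  · exact Set.ncard_singleton O
  · rw [Set.ncard_coe_finset, hB14]
end

section
/- If 𝒟 is a symmetric (15,8,4)-design of type (NC), then the action of Aut(𝒟) on the point set Fin 15 has exactly two orbits, of sizes 1 and 14 (one point is fixed by every automorphism and Aut(𝒟) acts transitively on the remaining 14 points), while the action of Aut(𝒟) on the set of blocks (where σ sends a block B to its image σ(B)) has exactly two orbits, of sizes 7 and 8. -/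
namespace SymmetricDesign

open Finset

/-! ### Counting lemmas -/

section Counting

variable {B : Finset (Finset (Fin 15))}

/-- The dual of a symmetric (15,8,4)-design has the same parameters. -/
lemma card_filter_mem_and_mem (hD : IsDesign B) (x y : Fin 15) :
    #{b ∈ B | x ∈ b ∧ y ∈ b} = if x = y then 8 else 4 := by
  obtain ⟨hcard, hsize, hinter⟩ := hD
  let e : Fin 15 ≃ B := (B.equivFinOfCardEq hcard).symm
  let M : Matrix (Fin 15) (Fin 15) ℚ := fun i x => if x ∈ (e i).1 then 1 else 0
  let H : Matrix (Fin 15) (Fin 15) ℚ := fun x i => (M i x - 1 / 2) / 4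
  have hMH : M * H = 1 := by
    ext i j
    have hsum : ∑ x, M i x = 8 := by
      simp [M, hsize _ (e i).2]
    have hprod : ∑ x, M i x * M j x = (#((e i).1 ∩ (e j).1) : ℚ) := by
      simp [M, ← ite_and, ← mem_inter, inter_comm]
    have hsplit : (M * H) i j = (∑ x, M i x * M j x - (∑ x, M i x) / 2) / 4 := by
      rw [Matrix.mul_apply, sum_div, ← sum_sub_distrib, sum_div]
      exact sum_congr rfl fun x _ => by simp only [H]; ring
    rw [hsplit, hsum, hprod, Matrix.one_apply]
    split_ifs with hij
    · subst hij
      rw [inter_self, hsize _ (e i).2]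
      norm_num
    · rw [hinter _ (e i).2 _ (e j).2 fun h => hij (e.injective (Subtype.ext h))]
      norm_num
  have hHM : H * M = 1 := mul_eq_one_comm.mp hMH
  have hentry : ∀ x y, ∑ i, M i x * M i y - (∑ i, M i y) / 2 = if x = y then 4 else 0 := by
    intro x y
    have h := congrFun (congrFun hHM x) y
    have hsplit : (H * M) x y = (∑ i, M i x * M i y - (∑ i, M i y) / 2) / 4 := by
      rw [Matrix.mul_apply, sum_div, ← sum_sub_distrib, sum_div]
      exact sum_congr rfl fun i _ => by simp only [H]; ring
    rw [hsplit, Matrix.one_apply] at h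
    split_ifs at h ⊢ <;> linarith
  have hdiag : ∀ y, ∑ i, M i y = 8 := by
    intro y
    have h := hentry y y
    have hsq : ∑ i, M i y * M i y = ∑ i, M i y :=
      sum_congr rfl fun i _ => by simp [M]
    rw [hsq, if_pos rfl] at h
    linarith
  have hcount : (#{b ∈ B | x ∈ b ∧ y ∈ b} : ℚ) = ∑ i, M i x * M i y := by
    rw [card_filter, ← sum_coe_sort B, ← e.sum_comp]
    push_cast
    exact sum_congr rfl fun i _ => by by_cases hx : x ∈ (e i).1 <;> simp [M, hx]
  have h := hentry x y
  rw [hdiag, ← hcount] at h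
  split_ifs at h ⊢
  · exact_mod_cast (by linarith : (#{b ∈ B | x ∈ b ∧ y ∈ b} : ℚ) = 8)
  · exact_mod_cast (by linarith : (#{b ∈ B | x ∈ b ∧ y ∈ b} : ℚ) = 4)

lemma sum_card_inter_eq (hD : IsDesign B) (X : Finset (Fin 15)) :
    ∑ b ∈ B, #(X ∩ b) = #X * 8 :=
  sum_card_inter fun x _ => by simpa using card_filter_mem_and_mem hD x x

lemma sum_card_inter_sq_eq (hD : IsDesign B) (X : Finset (Fin 15)) :
    ∑ b ∈ B, #(X ∩ b) ^ 2 = 4 * #X ^ 2 + 4 * #X := by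
  have hsq : ∀ b : Finset (Fin 15),
      #(X ∩ b) ^ 2 = ∑ x ∈ X, ∑ y ∈ X, if x ∈ b ∧ y ∈ b then 1 else 0 := by
    intro b
    rw [sq, ← filter_mem_eq_inter, card_filter, sum_mul_sum]
    simp [ite_and]
  simp_rw [hsq]
  rw [sum_comm]
  have hpair : ∀ x y : Fin 15, (∑ b ∈ B, if x ∈ b ∧ y ∈ b then 1 else 0)
      = 4 + if x = y then 4 else 0 := by
    intro x y
    rw [← card_filter, card_filter_mem_and_mem hD]
    split_ifs <;> rfl
  have hrow : ∀ x ∈ X, (∑ b ∈ B, ∑ y ∈ X, if x ∈ b ∧ y ∈ b then 1 else 0) = 4 * #X + 4 := by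
    intro x hx
    rw [sum_comm]
    simp_rw [hpair]
    simp [sum_add_distrib, hx, mul_comm]
  rw [sum_congr rfl hrow, sum_const, smul_eq_mul]
  ring

lemma card_filter_comp {α β : Type*} [Fintype α] [Fintype β] [DecidableEq β]
    (v : α → β) (g : β → Bool) :
    #{x | g (v x)} = ∑ c, if g c then #{x | v x = c} else 0 := by
  rw [card_eq_sum_card_fiberwise (f := v) (t := univ) fun _ _ => mem_coe.mpr (mem_univ _)]
  refine sum_congr rfl fun c _ => ?_
  rw [filter_filter]
  split_ifs with h
  · congr 1
    ext x
    simp only [mem_filter, mem_univ, true_and, and_iff_right_iff_imp]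
    rintro rfl
    exact h
  · rw [card_eq_zero, filter_eq_empty_iff]
    rintro x - ⟨hx, rfl⟩
    exact h hx

/-- The cardinalities of the fibres of `v` determine those of all sets that are unions of fibres. -/
lemma exists_fiber_card {α β : Type*} [Fintype α] [Fintype β] [DecidableEq β] (v : α → β) :
    ∃ N : β → ℕ, (∀ c, N c ≠ 0 → ∃ x, v x = c) ∧
      ∀ (X : Finset α) (g : β → Bool) (n : ℕ), #X = n → (∀ x, x ∈ X ↔ g (v x)) →
        n = ∑ c, if g c then N c else 0 := by
  refine ⟨fun c => #{x | v x = c}, fun c hc => ?_, fun X g n hn h => ?_⟩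
  · obtain ⟨x, hx⟩ := card_ne_zero.mp hc
    exact ⟨x, by simpa using hx⟩
  · rw [← card_filter_comp, ← hn]
    congr 1
    ext x
    simp [h]

end Counting

/-! ### A frame of five blocks -/

section Frame

variable {B : Finset (Finset (Fin 15))}

/-- The points lying in exactly two of three given sets. -/
def twiceCovered (O A C : Finset (Fin 15)) : Finset (Fin 15) :=
  {x | (x ∈ O ∧ x ∈ A ∧ x ∉ C) ∨ (x ∈ O ∧ x ∉ A ∧ x ∈ C) ∨ (x ∉ O ∧ x ∈ A ∧ x ∈ C)}

lemma eq_symmDiff_of_disjoint_inter {O A C : Finset (Fin 15)} (hC : #C = 8)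
    (hOC : #(O ∩ C) = 4) (hAC : #(A ∩ C) = 4) (hO : #O = 8) (hA : #A = 8) (hOA : #(O ∩ A) = 4)
    (h : #(O ∩ A ∩ C) = 0) : symmDiff O A = C := by
  have h1 : (O ∩ C) ∪ (A ∩ C) = C := by
    apply eq_of_subset_of_card_le (union_subset inter_subset_right inter_subset_right)
    rw [card_union_of_disjoint, hC, hOC, hAC]
    rw [disjoint_iff_inter_eq_empty, ← card_eq_zero, ← h]
    congr 1
    ext x
    simp only [mem_inter]
    tauto
  symm
  apply eq_of_subset_of_card_le
  · intro x hx
    have hx' := hx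
    rw [← h1] at hx'
    have hnot : x ∉ O ∩ A ∩ C := by
      rw [card_eq_zero.mp h]
      exact notMem_empty x
    simp only [mem_symmDiff, mem_union, mem_inter] at *
    tauto
  · rw [symmDiff_def, sup_eq_union, card_union_of_disjoint disjoint_sdiff_sdiff]
    have h2 := card_sdiff_add_card_inter O A
    have h3 := card_sdiff_add_card_inter A O
    rw [inter_comm] at h3
    omega

/-- Two blocks whose symmetric difference is not a block lie in a triple of blocks with three
common points. -/
lemma exists_card_inter_inter_eq_three (hD : IsDesign B) {O A : Finset (Fin 15)}
    (hO : O ∈ B) (hA : A ∈ B) (hAO : A ≠ O) (hOA : symmDiff O A ∉ B) :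
    ∃ C ∈ B, C ≠ O ∧ C ≠ A ∧ #(O ∩ A ∩ C) = 3 := by
  have hX : #(O ∩ A) = 4 := hD.2.2 O hO A hA hAO.symm
  by_contra! hne
  have hsub : {O, A} ⊆ B := by simp [insert_subset_iff, hO, hA]
  have hmem : ∀ C ∈ B \ {O, A}, C ∈ B ∧ C ≠ O ∧ C ≠ A := by
    intro C hC
    simpa using hC
  have hrest : ∀ C ∈ B \ {O, A},
      #(O ∩ A ∩ C) ^ 2 + 2 = 3 * #(O ∩ A ∩ C) := by
    intro C hC
    obtain ⟨hCB, hCO, hCA⟩ := hmem C hC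
    have hOC := hD.2.2 O hO C hCB hCO.symm
    have hAC := hD.2.2 A hA C hCB hCA.symm
    have h3 := hne C hCB hCO hCA
    have h0 : #(O ∩ A ∩ C) ≠ 0 := fun h =>
      hOA (eq_symmDiff_of_disjoint_inter (hD.2.1 C hCB) hOC hAC (hD.2.1 O hO) (hD.2.1 A hA)
        hX h ▸ hCB)
    have hle : #(O ∩ A ∩ C) ≤ 4 := hX ▸ card_le_card inter_subset_left
    have h4 : #(O ∩ A ∩ C) ≠ 4 := by
      intro h
      have hsplit := card_union_add_card_inter (O ∪ A) C
      have hsplit' := card_union_add_card_inter O A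
      have hsplit'' := card_union_add_card_inter (O ∩ C) (A ∩ C)
      rw [← union_inter_distrib_right, ← inter_inter_distrib_right, h] at hsplit''
      have := card_le_univ (O ∪ A ∪ C)
      have := hD.2.1 O hO
      have := hD.2.1 A hA
      have := hD.2.1 C hCB
      rw [Fintype.card_fin] at *
      omega
    interval_cases h : #(O ∩ A ∩ C) <;> simp_all
  have hsum := sum_card_inter_eq hD (O ∩ A)
  have hsq := sum_card_inter_sq_eq hD (O ∩ A)
  rw [← sum_sdiff hsub, sum_pair hAO.symm, inter_right_comm, inter_self, inter_assoc O A A,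
    inter_self, hX] at hsum hsq
  have hlin := sum_congr rfl hrest
  have hcard : #(B \ {O, A}) = 13 := by
    rw [card_sdiff_of_subset hsub, hD.1, card_pair hAO.symm]
  rw [sum_add_distrib, sum_const, hcard, ← mul_sum, smul_eq_mul] at hlin
  omega

lemma card_twiceCovered_and_even_card_inter (hD : IsDesign B) {O A C D : Finset (Fin 15)}
    (hO : O ∈ B) (hA : A ∈ B) (hC : C ∈ B) (hOA : O ≠ A) (hOC : O ≠ C) (hAC : A ≠ C)
    (h3 : #(O ∩ A ∩ C) = 3) (hDB : D ∈ B) :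
    #(twiceCovered O A C) = 3 ∧ Even #(twiceCovered O A C ∩ D) := by
  obtain ⟨N, -, key⟩ := exists_fiber_card fun x : Fin 15 =>
    (decide (x ∈ O), decide (x ∈ A), decide (x ∈ C), decide (x ∈ D))
  have hmeet : ∀ {X}, X ∈ B → (X = D ∧ #(X ∩ D) = 8) ∨ (X ≠ D ∧ #(X ∩ D) = 4) := by
    intro X hX
    rcases eq_or_ne X D with rfl | h
    · exact Or.inl ⟨rfl, by rw [inter_self, hD.2.1 X hX]⟩
    · exact Or.inr ⟨h, hD.2.2 X hX D hDB h⟩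
  obtain ⟨a, ha⟩ : ∃ a, #(O ∩ D) = a := ⟨_, rfl⟩
  obtain ⟨b, hb⟩ : ∃ b, #(A ∩ D) = b := ⟨_, rfl⟩
  obtain ⟨c, hc⟩ : ∃ c, #(C ∩ D) = c := ⟨_, rfl⟩
  obtain ⟨s, hs⟩ : ∃ s, #(twiceCovered O A C) = s := ⟨_, rfl⟩
  obtain ⟨t, ht⟩ : ∃ t, #(twiceCovered O A C ∩ D) = t := ⟨_, rfl⟩
  have e0 := key univ (fun _ => true) 15 rfl (by simp)
  have e1 := key O (fun c => c.1) 8 (hD.2.1 O hO) (by simp)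
  have e2 := key A (fun c => c.2.1) 8 (hD.2.1 A hA) (by simp)
  have e3 := key C (fun c => c.2.2.1) 8 (hD.2.1 C hC) (by simp)
  have e4 := key D (fun c => c.2.2.2) 8 (hD.2.1 D hDB) (by simp)
  have e5 := key (O ∩ A) (fun c => c.1 && c.2.1) 4 (hD.2.2 O hO A hA hOA) (by simp)
  have e6 := key (O ∩ C) (fun c => c.1 && c.2.2.1) 4 (hD.2.2 O hO C hC hOC) (by simp)
  have e7 := key (A ∩ C) (fun c => c.2.1 && c.2.2.1) 4 (hD.2.2 A hA C hC hAC) (by simp)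
  have e8 := key (O ∩ D) (fun c => c.1 && c.2.2.2) a ha (by simp)
  have e9 := key (A ∩ D) (fun c => c.2.1 && c.2.2.2) b hb (by simp)
  have e10 := key (C ∩ D) (fun c => c.2.2.1 && c.2.2.2) c hc (by simp)
  have e11 := key (O ∩ A ∩ C) (fun c => c.1 && c.2.1 && c.2.2.1) 3 h3 (by simp [and_assoc])
  have e12 := key (twiceCovered O A C)
    (fun c => (c.1 && c.2.1 && !c.2.2.1) || (c.1 && !c.2.1 && c.2.2.1)
      || (!c.1 && c.2.1 && c.2.2.1)) s hs (by simp [twiceCovered, and_assoc, or_assoc])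
  have e13 := key (twiceCovered O A C ∩ D)
    (fun c => ((c.1 && c.2.1 && !c.2.2.1) || (c.1 && !c.2.1 && c.2.2.1)
      || (!c.1 && c.2.1 && c.2.2.1)) && c.2.2.2) t ht
      (by simp [twiceCovered, and_assoc, or_assoc])
  have g1 := hmeet hO
  have g2 := hmeet hA
  have g3 := hmeet hC
  rw [hs, ht, Nat.even_iff]
  rw [ha] at g1
  rw [hb] at g2
  rw [hc] at g3
  clear key ha hb hc hs ht hmeet
  simp only [Fintype.sum_prod_type, Fintype.sum_bool, Bool.and_true, Bool.and_false, Bool.or_true,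
    Bool.or_false, Bool.not_true, Bool.not_false, Bool.false_eq_true, if_true, if_false]
    at e0 e1 e2 e3 e4 e5 e6 e7 e8 e9 e10 e11 e12 e13
  rcases g1 with ⟨g1, h1⟩ | ⟨g1, h1⟩ <;> rcases g2 with ⟨g2, h2⟩ | ⟨g2, h2⟩ <;>
    rcases g3 with ⟨g3, h3⟩ | ⟨g3, h3⟩
  · exact absurd (g1.trans g2.symm) hOA
  · exact absurd (g1.trans g2.symm) hOA
  · exact absurd (g1.trans g3.symm) hOC
  · omega
  · exact absurd (g2.trans g3.symm) hAC
  · omega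
  · omega
  · omega

/-- If three blocks have three common points, then two further blocks are disjoint from the set of
points that they cover twice. -/
lemma exists_disjoint_twiceCovered (hD : IsDesign B) {O A C : Finset (Fin 15)}
    (hO : O ∈ B) (hA : A ∈ B) (hC : C ∈ B) (hOA : O ≠ A) (hOC : O ≠ C) (hAC : A ≠ C)
    (h3 : #(O ∩ A ∩ C) = 3) :
    ∃ P ∈ B, ∃ Q ∈ B, P ≠ Q ∧ #(twiceCovered O A C ∩ P) = 0 ∧ #(twiceCovered O A C ∩ Q) = 0 := by
  have hcard : #(twiceCovered O A C) = 3 :=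
    (card_twiceCovered_and_even_card_inter hD hO hA hC hOA hOC hAC h3 hO).1
  have hsum := sum_card_inter_eq hD (twiceCovered O A C)
  have hval : ∀ b ∈ B, #(twiceCovered O A C ∩ b)
      = if #(twiceCovered O A C ∩ b) = 0 then 0 else 2 := by
    intro b hb
    have hle : #(twiceCovered O A C ∩ b) ≤ 3 := hcard ▸ card_le_card inter_subset_left
    have heven :=
      (card_twiceCovered_and_even_card_inter hD hO hA hC hOA hOC hAC h3 hb).2
    rw [Nat.even_iff] at heven
    split_ifs <;> omega
  rw [sum_congr rfl hval, sum_ite, sum_const, sum_const, hcard] at hsum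
  have hsplit := card_filter_add_card_filter_not (s := B)
    (fun b => #(twiceCovered O A C ∩ b) = 0)
  rw [hD.1] at hsplit
  simp only [smul_eq_mul] at hsum
  obtain ⟨P, hP, Q, hQ, hPQ⟩ := one_lt_card.mp
    (show 1 < #{b ∈ B | #(twiceCovered O A C ∩ b) = 0} by omega)
  rw [mem_filter] at hP hQ
  exact ⟨P, hP.1, Q, hQ.1, hPQ, hP.2, hQ.2⟩

/-- The set of points encoded by the binary digits of a natural number. -/
def ofMask (m : ℕ) : Finset (Fin 15) := {i | m.testBit i}

/-- The masks of five blocks that separate the points. -/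
def frame : List ℕ := [507, 3645, 28734, 28080, 23400]

/-- The incidences of a point with the frame. -/
def frameAtom (i : Fin 15) : Bool × Bool × Bool × Bool × Bool :=
  (Nat.testBit 507 i, Nat.testBit 3645 i, Nat.testBit 28734 i, Nat.testBit 28080 i,
    Nat.testBit 23400 i)

lemma frameAtom_injective : Function.Injective frameAtom := by
  decide +kernel

set_option maxHeartbeats 1000000 in
lemma exists_atom_eq_frameAtom (hD : IsDesign B) {O A C P Q : Finset (Fin 15)}
    (hO : O ∈ B) (hA : A ∈ B) (hC : C ∈ B) (hP : P ∈ B) (hQ : Q ∈ B)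
    (hOA : O ≠ A) (hOC : O ≠ C) (hAC : A ≠ C) (hPQ : P ≠ Q) (h3 : #(O ∩ A ∩ C) = 3)
    (hSP : #(twiceCovered O A C ∩ P) = 0) (hSQ : #(twiceCovered O A C ∩ Q) = 0) (i : Fin 15) :
    ∃ x, (decide (x ∈ O), decide (x ∈ A), decide (x ∈ C), decide (x ∈ P), decide (x ∈ Q))
      = frameAtom i := by
  obtain ⟨x, hx⟩ : ((O ∩ A) \ (O ∩ A ∩ C)).Nonempty := by
    rw [← card_pos, card_sdiff_of_subset inter_subset_left, h3, hD.2.2 O hO A hA hOA]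
    norm_num
  obtain ⟨y, hy⟩ : ((O ∩ C) \ (O ∩ A ∩ C)).Nonempty := by
    rw [← card_pos, card_sdiff_of_subset (inter_subset_inter_right inter_subset_left), h3,
      hD.2.2 O hO C hC hOC]
    norm_num
  simp only [mem_sdiff, mem_inter] at hx hy
  have hmeet : ∀ Y ∈ B, #(twiceCovered O A C ∩ Y) = 0 →
      #(O ∩ Y) = 4 ∧ #(A ∩ Y) = 4 ∧ #(C ∩ Y) = 4 := by
    intro Y hY h
    rw [card_eq_zero, eq_empty_iff_forall_notMem] at h
    have h1 := h x
    have h2 := h y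
    simp only [twiceCovered, mem_inter, mem_filter, mem_univ, true_and] at h1 h2
    refine ⟨hD.2.2 O hO Y hY ?_, hD.2.2 A hA Y hY ?_, hD.2.2 C hC Y hY ?_⟩ <;> rintro rfl <;>
      tauto
  obtain ⟨hOP, hAP, hCP⟩ := hmeet P hP hSP
  obtain ⟨hOQ, hAQ, hCQ⟩ := hmeet Q hQ hSQ
  obtain ⟨N, hN, key⟩ := exists_fiber_card fun x : Fin 15 =>
    (decide (x ∈ O), decide (x ∈ A), decide (x ∈ C), decide (x ∈ P), decide (x ∈ Q))
  have e0 := key univ (fun _ => true) 15 rfl (by simp)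
  have e1 := key O (fun c => c.1) 8 (hD.2.1 O hO) (by simp)
  have e2 := key A (fun c => c.2.1) 8 (hD.2.1 A hA) (by simp)
  have e3 := key C (fun c => c.2.2.1) 8 (hD.2.1 C hC) (by simp)
  have e4 := key P (fun c => c.2.2.2.1) 8 (hD.2.1 P hP) (by simp)
  have e5 := key Q (fun c => c.2.2.2.2) 8 (hD.2.1 Q hQ) (by simp)
  have e6 := key (O ∩ A) (fun c => c.1 && c.2.1) 4 (hD.2.2 O hO A hA hOA) (by simp)
  have e7 := key (O ∩ C) (fun c => c.1 && c.2.2.1) 4 (hD.2.2 O hO C hC hOC) (by simp)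
  have e8 := key (A ∩ C) (fun c => c.2.1 && c.2.2.1) 4 (hD.2.2 A hA C hC hAC) (by simp)
  have e9 := key (P ∩ Q) (fun c => c.2.2.2.1 && c.2.2.2.2) 4 (hD.2.2 P hP Q hQ hPQ) (by simp)
  have e10 := key (O ∩ P) (fun c => c.1 && c.2.2.2.1) 4 hOP (by simp)
  have e11 := key (A ∩ P) (fun c => c.2.1 && c.2.2.2.1) 4 hAP (by simp)
  have e12 := key (C ∩ P) (fun c => c.2.2.1 && c.2.2.2.1) 4 hCP (by simp)
  have e13 := key (O ∩ Q) (fun c => c.1 && c.2.2.2.2) 4 hOQ (by simp)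
  have e14 := key (A ∩ Q) (fun c => c.2.1 && c.2.2.2.2) 4 hAQ (by simp)
  have e15 := key (C ∩ Q) (fun c => c.2.2.1 && c.2.2.2.2) 4 hCQ (by simp)
  have e16 := key (O ∩ A ∩ C) (fun c => c.1 && c.2.1 && c.2.2.1) 3 h3 (by simp [and_assoc])
  have e17 := key (twiceCovered O A C ∩ P)
    (fun c => ((c.1 && c.2.1 && !c.2.2.1) || (c.1 && !c.2.1 && c.2.2.1)
      || (!c.1 && c.2.1 && c.2.2.1)) && c.2.2.2.1) 0 hSP
      (by simp [twiceCovered, and_assoc, or_assoc])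
  have e18 := key (twiceCovered O A C ∩ Q)
    (fun c => ((c.1 && c.2.1 && !c.2.2.1) || (c.1 && !c.2.1 && c.2.2.1)
      || (!c.1 && c.2.1 && c.2.2.1)) && c.2.2.2.2) 0 hSQ
      (by simp [twiceCovered, and_assoc, or_assoc])
  apply hN
  clear key hN
  simp only [Fintype.sum_prod_type, Fintype.sum_bool, Bool.and_true, Bool.and_false, Bool.or_true,
    Bool.or_false, Bool.not_true, Bool.not_false, Bool.false_eq_true, if_true, if_false]
    at e0 e1 e2 e3 e4 e5 e6 e7 e8 e9 e10 e11 e12 e13 e14 e15 e16 e17 e18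
  have e19 : 0 = N (false, false, false, true, true) + N (false, false, false, true, false) +
      (N (false, false, false, false, true) + N (false, false, false, false, false)) := by
    clear e4 e5 e9 e10 e11 e12 e13 e14 e15 e17 e18
    omega
  simp only [eq_comm (a := 0), Nat.add_eq_zero_iff, and_true, true_and] at e17 e18 e19
  simp only [e17, e18, e19, add_zero, zero_add]
    at e0 e1 e2 e3 e4 e5 e6 e7 e8 e9 e10 e11 e12 e13 e14 e15 e16
  have hrowP : N (true, true, true, true, true) + N (true, true, true, true, false) = 2 ∧
      N (true, false, false, true, true) + N (true, false, false, true, false) = 2 ∧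
      N (false, true, false, true, true) + N (false, true, false, true, false) = 2 ∧
      N (false, false, true, true, true) + N (false, false, true, true, false) = 2 := by
    clear e0 e1 e2 e3 e5 e6 e7 e8 e9 e13 e14 e15 e16
    omega
  have hrowQ : N (true, true, true, true, true) + N (true, true, true, false, true) = 2 ∧
      N (true, false, false, true, true) + N (true, false, false, false, true) = 2 ∧
      N (false, true, false, true, true) + N (false, true, false, false, true) = 2 ∧
      N (false, false, true, true, true) + N (false, false, true, false, true) = 2 := by
    clear e0 e1 e2 e3 e4 e6 e7 e8 e9 e10 e11 e12 e16 hrowP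
    omega
  have hrow : N (true, true, true, true, true) + N (true, true, true, true, false) +
        N (true, true, true, false, true) + N (true, true, true, false, false) = 3 ∧
      N (true, false, false, true, true) + N (true, false, false, true, false) +
        N (true, false, false, false, true) + N (true, false, false, false, false) = 3 ∧
      N (false, true, false, true, true) + N (false, true, false, true, false) +
        N (false, true, false, false, true) + N (false, true, false, false, false) = 3 ∧
      N (false, false, true, true, true) + N (false, false, true, true, false) +
        N (false, false, true, false, true) + N (false, false, true, false, false) = 3 := by
    clear e4 e5 e9 e10 e11 e12 e13 e14 e15 hrowP hrowQ
    omega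
  have hsingle : N (true, true, false, false, false) = 1 ∧ N (true, false, true, false, false) = 1 ∧
      N (false, true, true, false, false) = 1 := by
    clear e4 e5 e9 e10 e11 e12 e13 e14 e15 hrowP hrowQ hrow
    omega
  clear e0 e1 e2 e3 e4 e5 e6 e7 e8 e10 e11 e12 e13 e14 e15 e16 e17 e18 e19
  have hPQ' : N (true, true, true, true, true) = 1 ∧
      N (true, false, false, true, true) = 1 ∧
      N (false, true, false, true, true) = 1 ∧
      N (false, false, true, true, true) = 1 := by
    omega
  have hgrid : N (true, true, true, true, false) = 1 ∧ N (true, true, true, false, true) = 1 ∧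
        N (true, true, true, false, false) = 0 ∧
      N (true, false, false, true, false) = 1 ∧ N (true, false, false, false, true) = 1 ∧
        N (true, false, false, false, false) = 0 ∧
      N (false, true, false, true, false) = 1 ∧ N (false, true, false, false, true) = 1 ∧
        N (false, true, false, false, false) = 0 ∧
      N (false, false, true, true, false) = 1 ∧ N (false, false, true, false, true) = 1 ∧
        N (false, false, true, false, false) = 0 := by
    omega
  clear e9
  fin_cases i <;> simp [frameAtom, Nat.testBit, Nat.shiftRight_eq_div_pow] <;> omega

end Frame

/-! ### Renaming the points -/

section Transport

variable {B : Finset (Finset (Fin 15))}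

/-- The image of a block family under a permutation of the points. -/
def transport (e : Equiv.Perm (Fin 15)) (B : Finset (Finset (Fin 15))) : Finset (Finset (Fin 15)) :=
  B.image fun b => b.image e

lemma mem_transport {e : Equiv.Perm (Fin 15)} {c : Finset (Fin 15)} :
    c ∈ transport e B ↔ ∃ b ∈ B, b.image e = c := by
  simp [transport]

lemma image_mem_transport {e : Equiv.Perm (Fin 15)} {b : Finset (Fin 15)} :
    b.image e ∈ transport e B ↔ b ∈ B :=
  (image_injective e.injective).mem_finset_image

lemma transport_transport (e f : Equiv.Perm (Fin 15)) :
    transport e (transport f B) = transport (e * f) B := by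
  simp [transport, image_image, Function.comp_def]

lemma isDesign_transport (e : Equiv.Perm (Fin 15)) (hD : IsDesign B) :
    IsDesign (transport e B) := by
  refine ⟨by rw [transport, card_image_of_injective _ (image_injective e.injective), hD.1], ?_, ?_⟩
  · intro c hc
    obtain ⟨b, hb, rfl⟩ := mem_transport.mp hc
    rw [card_image_of_injective _ e.injective, hD.2.1 b hb]
  · intro c hc c' hc' hne
    obtain ⟨b, hb, rfl⟩ := mem_transport.mp hc
    obtain ⟨b', hb', rfl⟩ := mem_transport.mp hc'
    rw [← image_inter _ _ e.injective, card_image_of_injective _ e.injective]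
    exact hD.2.2 b hb b' hb' fun h => hne (h ▸ rfl)

lemma isCenter_of_isCenter_transport {e : Equiv.Perm (Fin 15)} {O : Finset (Fin 15)}
    (h : IsCenter (transport e B) (O.image e)) : IsCenter B O := by
  refine ⟨image_mem_transport.mp h.1, fun b hb hbO => ?_⟩
  have := h.2 _ (image_mem_transport.mpr hb) fun h => hbO (image_injective e.injective h)
  rwa [← image_symmDiff _ _ e.injective, image_mem_transport] at this

lemma not_isCenter_transport (e : Equiv.Perm (Fin 15)) (hNC : ∀ O, ¬ IsCenter B O)
    (O : Finset (Fin 15)) : ¬ IsCenter (transport e B) O := by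
  intro h
  obtain ⟨b, -, rfl⟩ := mem_transport.mp h.1
  exact hNC b (isCenter_of_isCenter_transport h)

/-- The points can be renamed such that a given design without center contains the frame. -/
lemma exists_transport_frame (hD : IsDesign B) (hNC : ∀ O, ¬ IsCenter B O) :
    ∃ e : Equiv.Perm (Fin 15), ∀ m ∈ frame, ofMask m ∈ transport e B := by
  obtain ⟨O, hO⟩ : B.Nonempty := by
    rw [← card_pos, hD.1]
    norm_num
  obtain ⟨A, hA, hAO, hOA⟩ : ∃ A ∈ B, A ≠ O ∧ symmDiff O A ∉ B := by
    by_contra! h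
    exact hNC O ⟨hO, h⟩
  obtain ⟨C, hC, hCO, hCA, h3⟩ := exists_card_inter_inter_eq_three hD hO hA hAO hOA
  obtain ⟨P, hP, Q, hQ, hPQ, hSP, hSQ⟩ :=
    exists_disjoint_twiceCovered hD hO hA hC hAO.symm hCO.symm hCA.symm h3
  choose g hg using exists_atom_eq_frameAtom hD hO hA hC hP hQ hAO.symm hCO.symm hCA.symm hPQ h3
    hSP hSQ
  have hinj : Function.Injective g := fun i j hij =>
    frameAtom_injective (by rw [← hg i, ← hg j, hij])
  let e : Equiv.Perm (Fin 15) := Equiv.ofBijective g (Finite.injective_iff_bijective.mp hinj)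
  refine ⟨e⁻¹, ?_⟩
  have key : ∀ {m : ℕ} {b : Finset (Fin 15)}, b ∈ B →
      (∀ i : Fin 15, decide (g i ∈ b) = m.testBit i) → ofMask m ∈ transport e⁻¹ B := by
    intro m b hb h
    refine mem_transport.mpr ⟨b, hb, ?_⟩
    ext i
    rw [ofMask, mem_filter_univ, ← h, decide_eq_true_iff]
    constructor
    · intro hi
      obtain ⟨x, hx, rfl⟩ := mem_image.mp hi
      rwa [show g (e⁻¹ x) = x from e.apply_symm_apply x]
    · exact fun hi => mem_image.mpr ⟨g i, hi, e.symm_apply_apply i⟩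
  simp only [frameAtom, Prod.mk.injEq] at hg
  simp only [frame, List.forall_mem_cons]
  exact ⟨key hO fun i => (hg i).1, key hA fun i => (hg i).2.1, key hC fun i => (hg i).2.2.1,
    key hP fun i => (hg i).2.2.2.1, key hQ fun i => (hg i).2.2.2.2, by simp⟩

end Transport

/-! ### Block families as lists of masks -/

section Masks

variable {B : Finset (Finset (Fin 15))}

/-- The number of nonzero digits among the last five binary digits, read off from a table
whose entries take four binary digits each. -/
def weightFive (m : ℕ) : ℕ :=
  (112004398439102515831086157106144944400 >>> (4 * (m % 32))) % 16

/-- The number of nonzero digits among the last 15 binary digits. -/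
def weight (m : ℕ) : ℕ :=
  weightFive m + weightFive (m / 32) + weightFive (m / 1024)

lemma weightFive_eq_sum (m : ℕ) : weightFive m = ∑ i ∈ range 5, (m.testBit i).toNat := by
  have hsmall : ∀ r < 32, weightFive r = ∑ i ∈ range 5, (r.testBit i).toNat := by decide +kernel
  calc weightFive m = weightFive (m % 2 ^ 5) := by simp [weightFive]
    _ = ∑ i ∈ range 5, ((m % 2 ^ 5).testBit i).toNat := hsmall _ (Nat.mod_lt _ (by norm_num))
    _ = ∑ i ∈ range 5, (m.testBit i).toNat := sum_congr rfl fun i hi => by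
      rw [Nat.testBit_mod_two_pow, decide_eq_true (mem_range.mp hi), Bool.true_and]

lemma weight_eq_sum (m : ℕ) : weight m = ∑ i ∈ range 15, (m.testBit i).toNat := by
  rw [weight, show 32 = 2 ^ 5 from rfl, show 1024 = 2 ^ 10 from rfl, weightFive_eq_sum,
    weightFive_eq_sum, weightFive_eq_sum, show 15 = 5 + 5 + 5 from rfl, sum_range_add _ (5 + 5) 5,
    sum_range_add _ 5 5]
  simp only [Nat.testBit_div_two_pow, Nat.reduceAdd, add_comm]

lemma mem_ofMask {m : ℕ} {i : Fin 15} : i ∈ ofMask m ↔ m.testBit i = true := by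
  simp [ofMask]

lemma card_ofMask (m : ℕ) : #(ofMask m) = weight m := by
  rw [weight_eq_sum, ofMask, card_filter,
    ← Fin.sum_univ_eq_sum_range (fun i => (m.testBit i).toNat)]
  exact sum_congr rfl fun i _ => by cases m.testBit i <;> rfl

lemma ofMask_inter (m n : ℕ) : ofMask m ∩ ofMask n = ofMask (m &&& n) := by
  ext i
  simp [mem_ofMask]

lemma symmDiff_ofMask (m n : ℕ) : symmDiff (ofMask m) (ofMask n) = ofMask (m ^^^ n) := by
  ext i
  rw [mem_symmDiff, mem_ofMask, mem_ofMask, mem_ofMask, Nat.testBit_xor]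
  cases m.testBit i <;> cases n.testBit i <;> decide

lemma image_ofMask {e : Equiv.Perm (Fin 15)} {m n : ℕ}
    (h : ∀ i : Fin 15, m.testBit i = n.testBit (e i)) : (ofMask m).image e = ofMask n := by
  ext i
  obtain ⟨j, rfl⟩ := e.surjective i
  rw [mem_ofMask, ← h, ← mem_ofMask, e.injective.mem_finset_image]

lemma exists_ofMask_eq (b : Finset (Fin 15)) : ∃ m < 2 ^ 15, ofMask m = b := by
  refine ⟨Nat.ofBits fun i => decide (i ∈ b), Nat.ofBits_lt_two_pow _, ?_⟩
  ext i
  rw [mem_ofMask, Nat.testBit_ofBits_lt _ _ i.isLt]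
  simp

/-- Test a predicate on all numbers whose binary expansion is that of `m` followed by `k`
digits. -/
def allExtensions (p : ℕ → Bool) : ℕ → ℕ → Bool
  | 0, m => p m
  | k + 1, m => allExtensions p k (2 * m) && allExtensions p k (2 * m + 1)

lemma of_allExtensions {p : ℕ → Bool} {k m n : ℕ} (h : allExtensions p k m = true)
    (hn : n / 2 ^ k = m) : p n = true := by
  induction k generalizing m with
  | zero => simpa [allExtensions, ← hn] using h
  | succ k ih =>
    rw [allExtensions, Bool.and_eq_true] at h
    rw [pow_succ, ← Nat.div_div_eq_div_mul] at hn
    rcases Nat.mod_two_eq_zero_or_one (n / 2 ^ k) with h2 | h2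
    · exact ih h.1 (by omega)
    · exact ih h.2 (by omega)

/-- The masks of weight 8 that meet each mask of the frame in weight 4. -/
def candidates : List ℕ :=
  [6054, 7062, 7398, 7510, 7566, 10086, 10982, 11094, 11150, 11598, 13221, 13669, 14040,
    14115, 14565, 14677, 14733, 15011, 15123, 15459, 15627, 18150, 18262, 18318, 19158, 19662,
    21397, 21733, 21845, 21901, 22179, 22291, 22741, 23187, 23635, 23691, 25317, 25429, 25485,
    25933, 26211, 26379, 26829, 27219, 27275, 27723]

lemma mem_candidates_of_weight {m : ℕ} (hm : m < 2 ^ 15) (h8 : weight m = 8)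
    (h4 : ∀ f ∈ frame, weight (m &&& f) = 4) : m ∈ candidates := by
  have h : allExtensions (fun n => !(weight n == 8) ||
      (!(frame.all fun f => weight (n &&& f) == 4) || candidates.contains n)) 15 0 = true := by
    decide +kernel
  have := of_allExtensions h (Nat.div_eq_of_lt hm)
  simp only [h8, beq_self_eq_true, Bool.not_true, Bool.false_or, Bool.or_eq_true,
    Bool.not_eq_true', List.contains_iff_mem] at this
  refine this.resolve_left fun hfalse => ?_
  rw [List.all_eq_true.mpr fun f hf => by simp [h4 f hf]] at hfalse
  exact absurd hfalse (by simp)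

lemma exists_mem_frame_append_candidates (hD : IsDesign B) (hF : ∀ m ∈ frame, ofMask m ∈ B) :
    ∀ b ∈ B, ∃ m ∈ frame ++ candidates, ofMask m = b := by
  intro b hb
  by_cases h : ∃ f ∈ frame, ofMask f = b
  · obtain ⟨f, hf, hfb⟩ := h
    exact ⟨f, List.mem_append_left _ hf, hfb⟩
  · push Not at h
    obtain ⟨m, hm, rfl⟩ := exists_ofMask_eq b
    refine ⟨m, List.mem_append_right _ (mem_candidates_of_weight hm ?_ fun f hf => ?_), rfl⟩
    · rw [← card_ofMask, hD.2.1 _ hb]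
    · rw [← card_ofMask, ← ofMask_inter, hD.2.2 _ hb _ (hF f hf) (h f hf).symm]

/-- Search through all pairwise compatible extensions of a list of masks by `candidates`,
discarding those that cannot reach 15 masks. -/
def search (leaf : List ℕ → Bool) : ℕ → List ℕ → List ℕ → Bool
  | _, chosen, [] => Nat.blt chosen.length 15 || leaf chosen
  | 0, _, _ :: _ => false
  | k + 1, chosen, c :: cs =>
    Nat.blt (chosen.length + cs.length) 14 ||
      (search leaf k (c :: chosen) (cs.filter fun m => weight (m &&& c) == 4) &&
        search leaf k chosen cs)

lemma length_ge_of_cover (hD : IsDesign B) {l : List ℕ} (h : ∀ b ∈ B, ∃ m ∈ l, ofMask m = b) :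
    15 ≤ l.length := by
  have hsub : B ⊆ l.toFinset.image ofMask := fun b hb => by simpa using h b hb
  calc 15 = #B := hD.1.symm
    _ ≤ #l.toFinset := (card_le_card hsub).trans card_image_le
    _ ≤ l.length := l.toFinset_card_le

lemma exists_leaf_of_search (hD : IsDesign B) {leaf : List ℕ → Bool} {k : ℕ} {chosen cs : List ℕ}
    (h : search leaf k chosen cs = true) (hB : ∀ m ∈ chosen, ofMask m ∈ B)
    (hcover : ∀ b ∈ B, ∃ m ∈ chosen ++ cs, ofMask m = b) :
    ∃ l, leaf l = true ∧ (∀ m ∈ l, ofMask m ∈ B) ∧ ∀ b ∈ B, ∃ m ∈ l, ofMask m = b := by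
  have hleaf : ∀ {chosen k}, search leaf k chosen [] = true →
      (∀ b ∈ B, ∃ m ∈ chosen ++ [], ofMask m = b) → leaf chosen = true := by
    intro chosen k h hcover
    have hlen := length_ge_of_cover hD hcover
    rw [List.append_nil] at hlen
    simp only [search, Bool.or_eq_true, Nat.blt_eq] at h
    exact h.resolve_left (by omega)
  induction k generalizing chosen cs with
  | zero =>
    cases cs with
    | nil => exact ⟨chosen, hleaf h hcover, hB, by simpa using hcover⟩
    | cons c cs => simp [search] at h
  | succ k ih =>
    cases cs with
    | nil => exact ⟨chosen, hleaf h hcover, hB, by simpa using hcover⟩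
    | cons c cs =>
      have hlen := length_ge_of_cover hD hcover
      simp only [search, Bool.or_eq_true, Bool.and_eq_true, Nat.blt_eq] at h
      rw [List.length_append, List.length_cons] at hlen
      obtain ⟨hin, hout⟩ := h.resolve_left (by omega)
      by_cases hc : ofMask c ∈ B
      · refine ih hin (List.forall_mem_cons.mpr ⟨hc, hB⟩) fun b hb => ?_
        by_cases hbc : ofMask c = b
        · exact ⟨c, by simp, hbc⟩
        · obtain ⟨m, hm, rfl⟩ := hcover b hb
          have hinter := hD.2.2 _ hb _ hc (Ne.symm hbc)
          rw [ofMask_inter, card_ofMask] at hinter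
          refine ⟨m, ?_, rfl⟩
          simp only [List.mem_append, List.mem_cons, List.mem_filter, beq_iff_eq] at hm ⊢
          rcases hm with hm | rfl | hm
          · exact Or.inl (Or.inr hm)
          · exact absurd rfl hbc
          · exact Or.inr ⟨hm, hinter⟩
      · refine ih hout hB fun b hb => ?_
        obtain ⟨m, hm, rfl⟩ := hcover b hb
        refine ⟨m, ?_, rfl⟩
        simp only [List.mem_append, List.mem_cons] at hm ⊢
        rcases hm with hm | rfl | hm
        · exact Or.inl hm
        · exact absurd hb hc
        · exact Or.inr hm

/-- The list of masks of a design without center. -/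
def standardMasks : List ℕ :=
  [507, 3645, 6054, 11598, 14040, 14565, 15123, 19158, 21845, 23400, 23691, 25485, 26211,
    28080, 28734]

/-- A design without center. -/
def standard : Finset (Finset (Fin 15)) := (standardMasks.map ofMask).toFinset

lemma mem_standard {b : Finset (Fin 15)} : b ∈ standard ↔ ∃ m ∈ standardMasks, ofMask m = b := by
  rw [standard, List.mem_toFinset, List.mem_map]

/-- Permutations that carry the designs found by the search to the standard one. -/
def permutations : List (Fin 15 → Fin 15) :=
  [![0, 1, 2, 3, 4, 5, 6, 7, 8, 9, 10, 11, 12, 13, 14],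
   ![0, 1, 2, 3, 5, 4, 6, 8, 7, 9, 11, 10, 12, 14, 13],
   ![0, 2, 1, 3, 4, 5, 9, 10, 11, 6, 7, 8, 12, 13, 14],
   ![0, 2, 1, 3, 5, 4, 9, 11, 10, 6, 8, 7, 12, 14, 13],
   ![1, 0, 2, 3, 4, 5, 6, 7, 8, 12, 13, 14, 9, 10, 11],
   ![1, 0, 2, 3, 5, 4, 6, 8, 7, 12, 14, 13, 9, 11, 10]]

/-- The list of masks has a center. -/
def hasCenter (l : List ℕ) : Bool :=
  l.any fun o => l.all fun m => m == o || l.contains (o ^^^ m)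

/-- The map `f` carries every mask in the list to a standard one. -/
def mapsToStandard (l : List ℕ) (f : Fin 15 → Fin 15) : Bool :=
  l.all fun m => standardMasks.any fun n =>
    decide (∀ i : Fin 15, m.testBit i = n.testBit (f i))

lemma search_frame :
    search (fun l => hasCenter l || permutations.any (mapsToStandard l)) 46 frame candidates
      = true := by
  decide +kernel

lemma isCenter_of_hasCenter {l : List ℕ} (hB : ∀ m ∈ l, ofMask m ∈ B)
    (hcover : ∀ b ∈ B, ∃ m ∈ l, ofMask m = b) (h : hasCenter l = true) : ∃ O, IsCenter B O := by
  simp only [hasCenter, List.any_eq_true, List.all_eq_true, Bool.or_eq_true, beq_iff_eq,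
    List.contains_iff_mem] at h
  obtain ⟨o, ho, h⟩ := h
  refine ⟨ofMask o, hB o ho, fun b hb hne => ?_⟩
  obtain ⟨m, hm, rfl⟩ := hcover b hb
  rw [symmDiff_ofMask]
  rcases h m hm with rfl | hmem
  · exact absurd rfl hne
  · exact hB _ hmem

lemma permutations_involutive : ∀ f ∈ permutations, Function.Involutive f := by
  have h : permutations.all (fun f => decide (∀ i, f (f i) = i)) = true := by decide +kernel
  simpa [List.all_eq_true, Function.Involutive] using h

lemma card_standard_le : #standard ≤ 15 :=
  calc #standard ≤ (standardMasks.map ofMask).length := List.toFinset_card_le _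
    _ = standardMasks.length := List.length_map _
    _ = 15 := rfl

lemma transport_eq_standard_of_mapsToStandard (hD : IsDesign B) {l : List ℕ}
    (hcover : ∀ b ∈ B, ∃ m ∈ l, ofMask m = b) {e : Equiv.Perm (Fin 15)}
    (h : mapsToStandard l e = true) : transport e B = standard := by
  apply eq_of_subset_of_card_le
  · intro c hc
    obtain ⟨b, hb, rfl⟩ := mem_transport.mp hc
    obtain ⟨m, hm, rfl⟩ := hcover b hb
    simp only [mapsToStandard, List.all_eq_true, List.any_eq_true, decide_eq_true_iff] at h
    obtain ⟨n, hn, hmn⟩ := h m hm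
    rw [image_ofMask hmn]
    exact mem_standard.mpr ⟨n, hn, rfl⟩
  · rw [(isDesign_transport e hD).1]
    exact card_standard_le

/-- Up to renaming points, there is only one design without center. -/
theorem exists_transport_eq_standard (hD : IsDesign B) (hNC : ∀ O, ¬ IsCenter B O) :
    ∃ e : Equiv.Perm (Fin 15), transport e B = standard := by
  obtain ⟨e, he⟩ := exists_transport_frame hD hNC
  have hD' := isDesign_transport e hD
  obtain ⟨l, hl, hB, hcover⟩ := exists_leaf_of_search hD' search_frame he
    (exists_mem_frame_append_candidates hD' he)
  rw [Bool.or_eq_true, List.any_eq_true] at hl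
  rcases hl with hl | ⟨f, hf, hl⟩
  · obtain ⟨O, hO⟩ := isCenter_of_hasCenter hB hcover hl
    exact absurd hO (not_isCenter_transport e hNC O)
  · refine ⟨(permutations_involutive f hf).toPerm f * e, ?_⟩
    rw [← transport_transport]
    exact transport_eq_standard_of_mapsToStandard hD' hcover hl

end Masks

/-! ### Automorphisms -/

section Orbits

variable {B : Finset (Finset (Fin 15))} {p : Fin 15}

/-- The automorphisms fix the point `p`, act transitively on the other points, and act
transitively on the eight blocks through `p` as well as on the blocks that avoid `p`. -/
structure SplitsAt (B : Finset (Finset (Fin 15))) (p : Fin 15) : Prop where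
  apply_eq : ∀ σ ∈ designAut B, σ p = p
  exists_apply_eq : ∀ x y, x ≠ p → y ≠ p → ∃ σ ∈ designAut B, σ x = y
  exists_image_eq : ∀ b ∈ B, ∀ b' ∈ B, (p ∈ b ↔ p ∈ b') → ∃ σ ∈ designAut B, b.image σ = b'
  card_filter_mem : #{b ∈ B | p ∈ b} = 8

lemma conj_mem_designAut {e σ : Equiv.Perm (Fin 15)} (h : σ ∈ designAut B) :
    e * σ * e⁻¹ ∈ designAut (transport e B) := by
  intro c hc
  obtain ⟨b, hb, rfl⟩ := mem_transport.mp hc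
  refine mem_transport.mpr ⟨b.image σ, h b hb, ?_⟩
  simp [image_image, Function.comp_def]

lemma transport_inv_transport (e : Equiv.Perm (Fin 15)) : transport e⁻¹ (transport e B) = B := by
  rw [transport_transport, inv_mul_cancel]
  simp [transport]

lemma SplitsAt.transport (h : SplitsAt B p) (e : Equiv.Perm (Fin 15)) :
    SplitsAt (transport e B) (e p) where
  apply_eq σ hσ := by
    have hconj := conj_mem_designAut (e := e⁻¹) hσ
    rw [transport_inv_transport] at hconj
    simpa [Equiv.symm_apply_eq, Equiv.Perm.inv_eq_iff_eq] using h.apply_eq _ hconj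
  exists_apply_eq x y hx hy := by
    obtain ⟨x, rfl⟩ := e.surjective x
    obtain ⟨y, rfl⟩ := e.surjective y
    obtain ⟨σ, hσ, rfl⟩ := h.exists_apply_eq x y (fun h => hx (h ▸ rfl)) (fun h => hy (h ▸ rfl))
    exact ⟨_, conj_mem_designAut hσ, by simp⟩
  exists_image_eq c hc c' hc' hcc' := by
    obtain ⟨b, hb, rfl⟩ := mem_transport.mp hc
    obtain ⟨b', hb', rfl⟩ := mem_transport.mp hc'
    simp only [e.injective.mem_finset_image] at hcc'
    obtain ⟨σ, hσ, rfl⟩ := h.exists_image_eq b hb b' hb' hcc'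
    exact ⟨_, conj_mem_designAut hσ, by simp [image_image, Function.comp_def]⟩
  card_filter_mem := by
    rw [SymmetricDesign.transport, filter_image,
      card_image_of_injective _ (image_injective e.injective)]
    simpa only [e.injective.mem_finset_image] using h.card_filter_mem

lemma SplitsAt.pointOrbit_eq (h : SplitsAt B p) (x : Fin 15) :
    pointOrbit B x = if x = p then {p} else {p}ᶜ := by
  ext y
  split_ifs with hx
  · subst hx
    constructor
    · rintro ⟨σ, hσ, rfl⟩
      exact h.apply_eq σ hσ
    · rintro rfl
      exact ⟨1, one_mem _, rfl⟩
  · constructor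
    · rintro ⟨σ, hσ, rfl⟩ (hy : σ x = p)
      exact hx (σ.injective (hy.trans (h.apply_eq σ hσ).symm))
    · intro hy
      obtain ⟨σ, hσ, hxy⟩ := h.exists_apply_eq x y hx hy
      exact ⟨σ, hσ, hxy.symm⟩

lemma SplitsAt.blockOrbit_eq (h : SplitsAt B p) {b : Finset (Fin 15)} (hb : b ∈ B) :
    blockOrbit B b = {b' ∈ B | p ∈ b ↔ p ∈ b'} := by
  ext b'
  rw [mem_coe, mem_filter]
  constructor
  · rintro ⟨σ, hσ, rfl⟩
    refine ⟨hσ b hb, ?_⟩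
    conv_rhs => rw [← h.apply_eq σ hσ]
    rw [σ.injective.mem_finset_image]
  · rintro ⟨hb', hbb'⟩
    obtain ⟨σ, hσ, himage⟩ := h.exists_image_eq b hb b' hb' hbb'
    exact ⟨σ, hσ, himage.symm⟩

lemma SplitsAt.setOf_pointOrbit_eq (h : SplitsAt B p) :
    {S | ∃ x, S = pointOrbit B x} = {{p}, {p}ᶜ} := by
  obtain ⟨q, hq⟩ := exists_ne p
  ext S
  simp only [Set.mem_ofPred_eq, Set.mem_insert_iff, Set.mem_singleton_iff]
  constructor
  · rintro ⟨x, rfl⟩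
    rw [h.pointOrbit_eq]
    split_ifs <;> simp
  · rintro (rfl | rfl)
    · exact ⟨p, by rw [h.pointOrbit_eq, if_pos rfl]⟩
    · exact ⟨q, by rw [h.pointOrbit_eq, if_neg hq]⟩

lemma SplitsAt.card_filter_notMem (h : SplitsAt B p) (hD : IsDesign B) : #{b ∈ B | p ∉ b} = 7 := by
  have := card_filter_add_card_filter_not (s := B) fun b => p ∈ b
  rw [h.card_filter_mem, hD.1] at this
  omega

lemma SplitsAt.setOf_blockOrbit_eq (h : SplitsAt B p) (hD : IsDesign B) :
    {T | ∃ b ∈ B, T = blockOrbit B b} =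
      {(({b ∈ B | p ∉ b} : Finset (Finset (Fin 15))) : Set (Finset (Fin 15))),
        (({b ∈ B | p ∈ b} : Finset (Finset (Fin 15))) : Set (Finset (Fin 15)))} := by
  ext T
  simp only [Set.mem_ofPred_eq, Set.mem_insert_iff, Set.mem_singleton_iff]
  constructor
  · rintro ⟨b, hb, rfl⟩
    rw [h.blockOrbit_eq hb]
    by_cases hpb : p ∈ b <;> simp [hpb]
  · rintro (rfl | rfl)
    · obtain ⟨b, hb⟩ : ({b ∈ B | p ∉ b} : Finset _).Nonempty := by
        rw [← card_pos, h.card_filter_notMem hD]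
        norm_num
      rw [mem_filter] at hb
      refine ⟨b, hb.1, ?_⟩
      rw [h.blockOrbit_eq hb.1]
      simp [hb.2]
    · obtain ⟨b, hb⟩ : ({b ∈ B | p ∈ b} : Finset _).Nonempty := by
        rw [← card_pos, h.card_filter_mem]
        norm_num
      rw [mem_filter] at hb
      refine ⟨b, hb.1, ?_⟩
      rw [h.blockOrbit_eq hb.1]
      simp [hb.2]

/-- The symmetric difference of any two blocks avoiding `x` is a block. -/
def IsPole (B : Finset (Finset (Fin 15))) (x : Fin 15) : Prop :=
  ∀ b ∈ B, ∀ b' ∈ B, x ∉ b → x ∉ b' → b ≠ b' → symmDiff b b' ∈ B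

lemma IsPole.of_apply {σ : Equiv.Perm (Fin 15)} (hσ : σ ∈ designAut B) {x : Fin 15}
    (h : IsPole B (σ x)) : IsPole B x := by
  intro b hb b' hb' hx hx' hne
  have := h _ (hσ b hb) _ (hσ b' hb') (by rwa [σ.injective.mem_finset_image])
    (by rwa [σ.injective.mem_finset_image]) ((image_injective σ.injective).ne hne)
  rw [← image_symmDiff _ _ σ.injective] at this
  have hinv := inv_mem hσ _ this
  rwa [image_image, show ⇑σ⁻¹ ∘ ⇑σ = id from funext fun x => by simp, image_id] at hinv

lemma eq_one_of_isPole {x : Fin 15} (h : IsPole standard x) : x = 1 := by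
  have hcheck : ∀ x : Fin 15, x ≠ 1 → ∃ m ∈ standardMasks, ∃ n ∈ standardMasks,
      m.testBit x = false ∧ n.testBit x = false ∧
        (∃ i : Fin 15, m.testBit i ≠ n.testBit i) ∧
        ∀ k ∈ standardMasks, ∃ i : Fin 15, k.testBit i ≠ (m ^^^ n).testBit i := by
    decide +kernel
  have hbit : ∀ {m n : ℕ}, ofMask m = ofMask n → ∀ i : Fin 15, m.testBit i = n.testBit i := by
    intro m n h i
    rw [Bool.eq_iff_iff, ← mem_ofMask, ← mem_ofMask, h]
  by_contra hx
  obtain ⟨m, hm, n, hn, hxm, hxn, ⟨i, hi⟩, hmn⟩ := hcheck x hx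
  have hsymm := h _ (mem_standard.mpr ⟨m, hm, rfl⟩) _ (mem_standard.mpr ⟨n, hn, rfl⟩)
    (by simp [mem_ofMask, hxm]) (by simp [mem_ofMask, hxn]) fun heq => hi (hbit heq i)
  rw [symmDiff_ofMask] at hsymm
  obtain ⟨k, hk, heq⟩ := mem_standard.mp hsymm
  obtain ⟨j, hj⟩ := hmn k hk
  exact hj (hbit heq j)

lemma isPole_standard : IsPole standard 1 := by
  have hcheck : ∀ m ∈ standardMasks, ∀ n ∈ standardMasks, m.testBit 1 = false →
      n.testBit 1 = false → m ≠ n → m ^^^ n ∈ standardMasks := by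
    decide +kernel
  intro b hb b' hb' h1 h1' hne
  obtain ⟨m, hm, rfl⟩ := mem_standard.mp hb
  obtain ⟨n, hn, rfl⟩ := mem_standard.mp hb'
  rw [symmDiff_ofMask]
  rw [mem_ofMask, Bool.not_eq_true] at h1 h1'
  exact mem_standard.mpr ⟨_, hcheck m hm n hn h1 h1' fun h => hne (h ▸ rfl), rfl⟩

/-- An automorphism of order 7 of the standard design. -/
def rotation : Equiv.Perm (Fin 15) where
  toFun := ![3, 1, 9, 4, 7, 6, 8, 5, 0, 10, 13, 12, 14, 11, 2]
  invFun := ![8, 1, 14, 0, 3, 7, 5, 4, 6, 2, 9, 13, 11, 10, 12]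
  left_inv := by decide
  right_inv := by decide

/-- An automorphism of order 2 of the standard design. -/
def reflection : Equiv.Perm (Fin 15) where
  toFun := ![0, 1, 2, 3, 10, 11, 12, 7, 14, 9, 4, 5, 6, 13, 8]
  invFun := ![0, 1, 2, 3, 10, 11, 12, 7, 14, 9, 4, 5, 6, 13, 8]
  left_inv := by decide
  right_inv := by decide

lemma mem_designAut_standard {σ : Equiv.Perm (Fin 15)}
    (h : ∀ m ∈ standardMasks, ∃ n ∈ standardMasks, ∀ i : Fin 15, m.testBit i = n.testBit (σ i)) :
    σ ∈ designAut standard := by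
  intro b hb
  obtain ⟨m, hm, rfl⟩ := mem_standard.mp hb
  obtain ⟨n, hn, hmn⟩ := h m hm
  exact mem_standard.mpr ⟨n, hn, (image_ofMask hmn).symm⟩

/-- Products of powers of the two automorphisms of the standard design. -/
def word (i : Fin 7) (j : Fin 2) (k : Fin 7) : Equiv.Perm (Fin 15) :=
  rotation ^ (i : ℕ) * reflection ^ (j : ℕ) * rotation ^ (k : ℕ)

lemma word_mem_designAut (i : Fin 7) (j : Fin 2) (k : Fin 7) : word i j k ∈ designAut standard := by
  have hrot : rotation ∈ designAut standard := mem_designAut_standard (by decide +kernel)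
  have href : reflection ∈ designAut standard := mem_designAut_standard (by decide +kernel)
  exact mul_mem (mul_mem (pow_mem hrot _) (pow_mem href _)) (pow_mem hrot _)

lemma splitsAt_standard : SplitsAt standard 1 where
  apply_eq σ hσ := by
    have h : IsPole standard (σ⁻¹ 1) := by
      refine IsPole.of_apply hσ ?_
      rw [show σ (σ⁻¹ 1) = 1 by simp]
      exact isPole_standard
    rw [← Equiv.Perm.inv_eq_iff_eq.mp (eq_one_of_isPole h)]
  exists_apply_eq x y hx hy := by
    have hcheck : ∀ x y : Fin 15, x ≠ 1 → y ≠ 1 → ∃ i j k, word i j k x = y := by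
      decide +kernel
    obtain ⟨i, j, k, h⟩ := hcheck x y hx hy
    exact ⟨_, word_mem_designAut i j k, h⟩
  exists_image_eq b hb b' hb' hbb' := by
    have hcheck : ∀ m ∈ standardMasks, ∀ n ∈ standardMasks, m.testBit 1 = n.testBit 1 →
        ∃ i j k, ∀ x : Fin 15, m.testBit x = n.testBit (word i j k x) := by
      decide +kernel
    obtain ⟨m, hm, rfl⟩ := mem_standard.mp hb
    obtain ⟨n, hn, rfl⟩ := mem_standard.mp hb'
    rw [mem_ofMask, mem_ofMask, ← Bool.eq_iff_iff] at hbb'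
    obtain ⟨i, j, k, h⟩ := hcheck m hm n hn hbb'
    exact ⟨_, word_mem_designAut i j k, image_ofMask h⟩
  card_filter_mem := by decide +kernel

end Orbits

end SymmetricDesign
/-- for a design of type (NC), the action of `Aut(𝒟)` on points has
exactly two orbits of sizes 1 and 14, and the action on blocks has exactly two orbits
of sizes 7 and 8. -/
theorem stmt17 (B : Finset (Finset (Fin 15))) (hD : IsDesign B)
    (hNC : ∀ O, ¬ IsCenter B O) :
    (∃ S₁ S₂ : Set (Fin 15),
      {S | ∃ x : Fin 15, S = pointOrbit B x} = {S₁, S₂} ∧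
      S₁.ncard = 1 ∧ S₂.ncard = 14) ∧
    (∃ T₁ T₂ : Set (Finset (Fin 15)),
      {T | ∃ b ∈ B, T = blockOrbit B b} = {T₁, T₂} ∧
      T₁.ncard = 7 ∧ T₂.ncard = 8) := by
  obtain ⟨e, he⟩ := SymmetricDesign.exists_transport_eq_standard hD hNC
  have h := SymmetricDesign.splitsAt_standard.transport e⁻¹
  rw [← he, SymmetricDesign.transport_inv_transport] at h
  refine ⟨⟨_, _, h.setOf_pointOrbit_eq, Set.ncard_singleton _, ?_⟩,
    ⟨_, _, h.setOf_blockOrbit_eq hD, ?_, ?_⟩⟩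
  · rw [Set.ncard_compl, Set.ncard_singleton, Nat.card_fin]
  · rw [Set.ncard_coe_finset, h.card_filter_notMem hD]
  · rw [Set.ncard_coe_finset, h.card_filter_mem]
end
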